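/- arXiv:1607.06639 — 5 statements merged into one kernel-verified Lean document; each statement's English description precedes it below -/
import Mathlib

section
/- Let E be a weighted geometric mean closed Archimedean vector lattice, let F be a weighted geometric mean closed Archimedean vector lattice, let G be a vector sublattice of E (not assumed weighted geometric mean closed), and let T : G → F be a vector lattice homomorphism. Let n ≥ 1 and r₁, …, rₙ ∈ (0,1) with r₁ + ⋯ + rₙ = 1. If f₁, …, fₙ ∈ G and the element △ₖ₌₁ⁿ (fₖ, rₖ), computed in E, belongs to G, then T( △ₖ₌₁ⁿ (fₖ, rₖ) ) = △ₖ₌₁ⁿ ( T(fₖ), rₖ ). -/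
/-- The set whose infimum (when it exists) is the weighted geometric mean
`△ₖ₌₁ⁿ (fₖ, rₖ) = inf { Σₖ rₖ·θₖ·|fₖ| : θₖ ∈ (0,∞), ∏ₖ θₖ^{rₖ} = 1 }`. -/
def wSet {E : Type*} [AddCommGroup E] [Lattice E] [Module ℝ E]
    (n : ℕ) (f : Fin n → E) (r : Fin n → ℝ) : Set E :=
  {x | ∃ θ : Fin n → ℝ, (∀ k, 0 < θ k) ∧ (∏ k, θ k ^ r k) = 1 ∧
      x = ∑ k, (r k * θ k) • |f k|}


/-- Finite approximation: finitely many admissible `θ` dominate all admissible ones up to `ε`. -/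
lemma finite_theta (n : ℕ) (r : Fin n → ℝ) (hr : ∀ k, 0 < r k) (hr1 : (∑ k, r k) = 1)
    (ε : ℝ) (hε : 0 < ε) :
    ∃ S : Finset (Fin n → ℝ), S.Nonempty ∧
      (∀ θ ∈ S, (∀ k, 0 < θ k) ∧ (∏ k, θ k ^ r k) = 1) ∧
      ∀ θ' : Fin n → ℝ, (∀ k, 0 < θ' k) → (∏ k, θ' k ^ r k) = 1 →
        ∃ θ ∈ S, ∀ k, θ k ≤ θ' k + ε := by
  classical
  let P : (Fin n → ℕ) → Prop := fun j =>
    (∀ k, 0 < j k) ∧ 1 ≤ ∏ k, (ε * (j k : ℝ)) ^ r k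
  let nrm : (Fin n → ℕ) → (Fin n → ℝ) := fun j k =>
    (ε * (j k : ℝ)) / ∏ i, (ε * (j i : ℝ)) ^ r i
  have hfin : {j | Minimal P j}.Finite :=
    WellQuasiOrderedLE.finite_of_isAntichain (setOfPred_minimal_antichain P)
  have key : ∀ θ' : Fin n → ℝ, (∀ k, 0 < θ' k) → (∏ k, θ' k ^ r k) = 1 →
        ∃ θ ∈ hfin.toFinset.image nrm, ∀ k, θ k ≤ θ' k + ε := by
    intro θ' h0 h1
    have hP : P (fun k => ⌈θ' k / ε⌉₊) := by
      refine ⟨fun k => Nat.ceil_pos.2 (div_pos (h0 k) hε), ?_⟩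
      rw [← h1]
      refine Finset.prod_le_prod (fun k _ => Real.rpow_nonneg (h0 k).le _) (fun k _ => ?_)
      refine Real.rpow_le_rpow (h0 k).le ?_ (hr k).le
      have := Nat.le_ceil (θ' k / ε)
      rw [div_le_iff₀ hε] at this
      linarith
    obtain ⟨j, hj, hmin⟩ := exists_minimal_le_of_wellFoundedLT P _ hP
    refine ⟨nrm j, Finset.mem_image_of_mem _ (by simpa using hmin), fun k => ?_⟩
    have h2 : nrm j k ≤ ε * (j k : ℝ) := div_le_self (by positivity) hmin.prop.2
    have h3 : (j k : ℝ) ≤ (⌈θ' k / ε⌉₊ : ℝ) := by exact_mod_cast hj k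
    have h4 := Nat.ceil_lt_add_one (div_pos (h0 k) hε).le
    have h5 : (j k : ℝ) ≤ θ' k / ε + 1 := by linarith
    have h6 : ε * (j k : ℝ) ≤ ε * (θ' k / ε + 1) := by gcongr
    have h7 : ε * (θ' k / ε + 1) = θ' k + ε := by field_simp
    linarith
  refine ⟨hfin.toFinset.image nrm, ?_, ?_, key⟩
  · obtain ⟨θ, h, -⟩ := key (fun _ => 1) (fun _ => one_pos) (by simp)
    exact ⟨θ, h⟩
  · intro θ hθ
    obtain ⟨j, hj, rfl⟩ := Finset.mem_image.1 hθ
    have hm : Minimal P j := by simpa using hj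
    have hpos : ∀ k, 0 < ε * (j k : ℝ) := fun k =>
      mul_pos hε (by exact_mod_cast hm.prop.1 k)
    have hC : 0 < ∏ i, (ε * (j i : ℝ)) ^ r i := lt_of_lt_of_le one_pos hm.prop.2
    refine ⟨fun k => div_pos (hpos k) hC, ?_⟩
    have : ∀ k, nrm j k ^ r k
        = (ε * (j k : ℝ)) ^ r k / (∏ i, (ε * (j i : ℝ)) ^ r i) ^ r k := fun k =>
      Real.div_rpow (hpos k).le hC.le _
    simp only [this]
    rw [Finset.prod_div_distrib, ← Real.rpow_sum_of_pos hC, hr1, Real.rpow_one, div_self (ne_of_gt hC)]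

/-- Finite infima in the sublattice `G`, compatible with `T`. -/
lemma finite_inf {E F ι : Type*} [AddCommGroup E] [Lattice E] [IsOrderedAddMonoid E]
    [Module ℝ E] [AddCommGroup F] [Lattice F] [IsOrderedAddMonoid F] [Module ℝ F]
    (G : Submodule ℝ E) (hGsup : ∀ x y : E, x ∈ G → y ∈ G → x ⊔ y ∈ G)
    (T : G →ₗ[ℝ] F)
    (hThom : ∀ (x y : E) (hx : x ∈ G) (hy : y ∈ G),
      T ⟨x ⊔ y, hGsup x y hx hy⟩ = T ⟨x, hx⟩ ⊔ T ⟨y, hy⟩)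
    (g : ι → G) (S : Finset ι) (hS : S.Nonempty) :
    ∃ h : G, (∀ i ∈ S, (h : E) ≤ g i) ∧ ∀ y : F, (∀ i ∈ S, y ≤ T (g i)) → y ≤ T h := by
  induction hS using Finset.Nonempty.cons_induction with
  | singleton a => exact ⟨g a, by simp, by simp⟩
  | cons a s ha hs ih =>
    obtain ⟨h, h1, h2⟩ := ih
    let w : G := ⟨(-(g a) : G) ⊔ (-h : G), hGsup _ _ (-(g a)).2 (-h).2⟩
    have hw : T w = (-T (g a)) ⊔ (-T h) := by
      have := hThom _ _ (-(g a)).2 (-h).2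
      simpa only [Subtype.coe_eta, map_neg] using this
    refine ⟨-w, ?_, ?_⟩
    · have e1 : ((-w : G) : E) ≤ g a := by
        have : -(g a : E) ≤ (w : E) := le_sup_left
        simpa using neg_le.1 this
      have e2 : ((-w : G) : E) ≤ h := by
        have : -(h : E) ≤ (w : E) := le_sup_right
        simpa using neg_le.1 this
      intro i hi
      rcases Finset.mem_cons.1 hi with rfl | hi
      · exact e1
      · exact e2.trans (h1 i hi)
    · intro y hy
      rw [map_neg, hw, le_neg]
      refine sup_le (neg_le_neg (hy a (Finset.mem_cons_self a s))) (neg_le_neg (h2 y ?_))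
      exact fun i hi => hy i (Finset.mem_cons_of_mem hi)

/-- **Proposition 4.1(3) (real case).** If `G` is a vector sublattice of `E`,
`T : G → F` is a vector lattice homomorphism, `f₁, …, fₙ ∈ G`, and the weighted geometric
mean `△ₖ₌₁ⁿ (fₖ, rₖ)` computed in `E` lies in `G`, then
`T(△ₖ₌₁ⁿ (fₖ, rₖ)) = △ₖ₌₁ⁿ (T(fₖ), rₖ)`. -/
theorem stmt10 {E : Type*} [AddCommGroup E] [Lattice E]
    [CovariantClass E E (· + ·) (· ≤ ·)]
    [Module ℝ E] [PosSMulMono ℝ E]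
    {F : Type*} [AddCommGroup F] [Lattice F]
    [CovariantClass F F (· + ·) (· ≤ ·)]
    [Module ℝ F] [PosSMulMono ℝ F]
    (harchE : ∀ f g : E, (∀ n : ℕ, (n : ℝ) • f ≤ g) → f ≤ 0)
    (harchF : ∀ f g : F, (∀ n : ℕ, (n : ℝ) • f ≤ g) → f ≤ 0)
    (hwgmE : ∀ (n : ℕ) (f : Fin n → E) (r : Fin n → ℝ),
      (∀ k, 0 < r k ∧ r k < 1) → (∑ k, r k) = 1 → ∃ m, IsGLB (wSet n f r) m)
    (hwgmF : ∀ (n : ℕ) (f : Fin n → F) (r : Fin n → ℝ),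
      (∀ k, 0 < r k ∧ r k < 1) → (∑ k, r k) = 1 → ∃ m, IsGLB (wSet n f r) m)
    (G : Submodule ℝ E) (hGsup : ∀ x y : E, x ∈ G → y ∈ G → x ⊔ y ∈ G)
    (T : G →ₗ[ℝ] F)
    (hThom : ∀ (x y : E) (hx : x ∈ G) (hy : y ∈ G),
      T ⟨x ⊔ y, hGsup x y hx hy⟩ = T ⟨x, hx⟩ ⊔ T ⟨y, hy⟩)
    (n : ℕ) (hn : 1 ≤ n)
    (r : Fin n → ℝ) (hr : ∀ k, 0 < r k ∧ r k < 1) (hr1 : (∑ k, r k) = 1)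
    (f : Fin n → E) (hf : ∀ k, f k ∈ G)
    (m : E) (hm : IsGLB (wSet n f r) m) (hmG : m ∈ G)
    (m' : F) (hm' : IsGLB (wSet n (fun k => T ⟨f k, hf k⟩) r) m') :
    T ⟨m, hmG⟩ = m' := by
  have : IsOrderedAddMonoid E := { add_le_add_left := fun a b h c => add_le_add_left h c }
  have : IsOrderedAddMonoid F := { add_le_add_left := fun a b h c => add_le_add_left h c }
  have habsG : ∀ x : E, x ∈ G → |x| ∈ G := fun x hx => hGsup _ _ hx (G.neg_mem hx)
  have hTabs : ∀ (x : E) (hx : x ∈ G), T ⟨|x|, habsG x hx⟩ = |T ⟨x, hx⟩| := by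
    intro x hx
    have h1 := hThom x (-x) hx (G.neg_mem hx)
    have h2 : T ⟨-x, G.neg_mem hx⟩ = -T ⟨x, hx⟩ := by
      rw [← map_neg]; rfl
    rw [h2] at h1
    exact h1
  have hTmono : ∀ x y : G, (x : E) ≤ y → T x ≤ T y := by
    intro x y hxy
    have h1 := hThom x y x.2 y.2
    have h2 : (⟨(x : E) ⊔ y, hGsup x y x.2 y.2⟩ : G) = y := Subtype.ext (sup_eq_right.2 hxy)
    rw [h2] at h1
    have h3 : T y = T x ⊔ T y := h1
    rw [h3]; exact le_sup_left
  let a : Fin n → G := fun k => ⟨|f k|, habsG _ (hf k)⟩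
  have ha : ∀ k, T (a k) = |T ⟨f k, hf k⟩| := fun k => hTabs _ _
  let φ : (Fin n → ℝ) → G := fun θ => ∑ k, (r k * θ k) • a k
  have hφE : ∀ θ, (φ θ : E) = ∑ k, (r k * θ k) • |f k| := by
    intro θ; simp [φ, a]
  have hφF : ∀ θ, T (φ θ) = ∑ k, (r k * θ k) • |T ⟨f k, hf k⟩| := by
    intro θ; simp [φ, ha]
  apply le_antisymm
  · apply hm'.2
    rintro x ⟨θ, h0, h1, rfl⟩
    rw [← hφF]
    apply hTmono
    rw [hφE]
    exact hm.1 ⟨θ, h0, h1, rfl⟩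
  · have main : ∀ ε : ℝ, 0 < ε → m' ≤ T ⟨m, hmG⟩ + ε • T (φ fun _ => 1) := by
      intro ε hε
      obtain ⟨S, hS, hS1, hS2⟩ := finite_theta n r (fun k => (hr k).1) hr1 ε hε
      obtain ⟨h, hh1, hh2⟩ := finite_inf G hGsup T hThom φ S hS
      have h3 : m' ≤ T h := hh2 _ fun θ hθ => by
        rw [hφF]
        exact hm'.1 ⟨θ, (hS1 θ hθ).1, (hS1 θ hθ).2, rfl⟩
      have h4 : ((h - ε • φ (fun _ => 1) : G) : E) ≤ m := by
        apply hm.2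
        rintro x ⟨θ', h0, h1, rfl⟩
        obtain ⟨θ, hθ, hle⟩ := hS2 θ' h0 h1
        have h5 := hh1 θ hθ
        have h6 : (φ θ : E) ≤ ∑ k, (r k * θ' k) • |f k| + ε • (φ (fun _ => 1) : E) := by
          rw [hφE, hφE, Finset.smul_sum, ← Finset.sum_add_distrib]
          refine Finset.sum_le_sum fun k _ => ?_
          rw [smul_smul, ← add_smul, ← sub_nonneg, ← sub_smul]
          refine smul_nonneg ?_ (abs_nonneg _)
          nlinarith [mul_le_mul_of_nonneg_left (hle k) (hr k).1.le]
        have h7 := h5.trans h6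
        simpa [sub_le_iff_le_add] using h7
      have h5 := hTmono _ ⟨m, hmG⟩ h4
      rw [map_sub, map_smul, sub_le_iff_le_add] at h5
      exact h3.trans h5
    rw [← sub_nonpos]
    apply harchF _ (T (φ fun _ => 1))
    intro N
    rcases Nat.eq_zero_or_pos N with rfl | hN
    · rw [hφF]
      simp only [Nat.cast_zero, zero_smul]
      exact Finset.sum_nonneg fun k _ => smul_nonneg (by have := (hr k).1; linarith) (abs_nonneg _)
    · have hN' : (0 : ℝ) < N := by exact_mod_cast hN
      have h1 := main (N : ℝ)⁻¹ (inv_pos.2 hN')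
      rw [← sub_le_iff_le_add'] at h1
      have h2 := smul_le_smul_of_nonneg_left h1 hN'.le
      rwa [smul_smul, mul_inv_cancel₀ hN'.ne', one_smul] at h2
end

section
/- Let A be a weighted geometric mean closed Archimedean Φ-algebra. Let n ≥ 1, let N, m₁, …, mₙ be positive integers with m₁ + ⋯ + mₙ = N and 0 < mₖ < N for each k, and set qₖ = mₖ/N. Then for all a₁, …, aₙ ∈ A⁺, the element △ₖ₌₁ⁿ (aₖ, qₖ) is nonnegative and satisfies ( △ₖ₌₁ⁿ (aₖ, qₖ) )^N = ∏ₖ₌₁ⁿ aₖ^{mₖ}; i.e., △ₖ₌₁ⁿ (aₖ, qₖ) = ∏ₖ₌₁ⁿ aₖ^{qₖ}. -/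
section helpers

variable {A : Type*} [CommRing A] [Lattice A] [IsOrderedRing A] [Algebra ℝ A] [PosSMulMono ℝ A]

lemma aux_am_nonneg (r : ℝ) (hr : 0 ≤ r) : (0 : A) ≤ algebraMap ℝ A r := by
  rw [Algebra.algebraMap_eq_smul_one]
  exact smul_nonneg hr zero_le_one

lemma aux_smul_cancel (r : ℝ) (hr : 0 < r) (x y : A)
    (h : algebraMap ℝ A r * x ≤ algebraMap ℝ A r * y) : x ≤ y := by
  have h2 := mul_le_mul_of_nonneg_left h (aux_am_nonneg (A := A) r⁻¹ (by positivity))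
  rw [← mul_assoc, ← mul_assoc, ← map_mul, inv_mul_cancel₀ hr.ne', map_one, one_mul, one_mul] at h2
  exact h2

/-- Archimedean property in a convenient form. -/
lemma aux_arch (harch : ∀ f g : A, (∀ n : ℕ, (n : ℝ) • f ≤ g) → f ≤ 0)
    (x y : A) (hy : 0 ≤ y)
    (h : ∀ n : ℕ, x ≤ algebraMap ℝ A (1 / ((n : ℝ) + 1)) * y) : x ≤ 0 := by
  apply harch x y
  intro n
  rcases n with _ | n
  · simpa using hy
  · have h2 := mul_le_mul_of_nonneg_left (h n) (aux_am_nonneg (A := A) ((n : ℝ) + 1) (by positivity))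
    rw [← mul_assoc, ← map_mul] at h2
    have : ((n : ℝ) + 1) * (1 / ((n : ℝ) + 1)) = 1 := by field_simp
    rw [this, map_one, one_mul] at h2
    rw [Algebra.smul_def]
    push_cast at h2 ⊢
    simpa using h2

lemma aux_mul_inf (hfalg : ∀ a b c : A, a ⊓ b = 0 → 0 ≤ c → (c * a) ⊓ b = 0)
    (c x y : A) (hc : 0 ≤ c) : (c * x) ⊓ (c * y) = c * (x ⊓ y) := by
  have h0 : (x - x ⊓ y) ⊓ (y - x ⊓ y) = 0 := by
    rw [← inf_sub, sub_self]
  have h1 := hfalg _ _ c h0 hc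
  rw [inf_comm] at h1
  have h2 := hfalg _ _ c h1 hc
  have : c * x ⊓ c * y = (c * (y - x ⊓ y) ⊓ c * (x - x ⊓ y)) + c * (x ⊓ y) := by
    rw [inf_add, inf_comm]; congr 1 <;> ring
  rw [this, h2, zero_add]

lemma aux_le_mul_inf (hfalg : ∀ a b c : A, a ⊓ b = 0 → 0 ≤ c → (c * a) ⊓ b = 0)
    (c x y p : A) (hc : 0 ≤ c) (h1 : p ≤ c * x) (h2 : p ≤ c * y) : p ≤ c * (x ⊓ y) := by
  rw [← aux_mul_inf hfalg c x y hc]; exact le_inf h1 h2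

lemma aux_cancel (hfalg : ∀ a b c : A, a ⊓ b = 0 → 0 ≤ c → (c * a) ⊓ b = 0)
    (ε : ℝ) (hε : 0 < ε) (c x y : A) (hc : algebraMap ℝ A ε ≤ c) (h : c * x ≤ c * y) :
    x ≤ y := by
  have hc0 : 0 ≤ c := (aux_am_nonneg ε hε.le).trans hc
  have h1 : c * (x ⊓ y) = c * x := by
    rw [← aux_mul_inf hfalg c x y hc0]; exact inf_eq_left.2 h
  have h2 : algebraMap ℝ A ε * (x - x ⊓ y) ≤ algebraMap ℝ A ε * 0 := by
    calc algebraMap ℝ A ε * (x - x ⊓ y) ≤ c * (x - x ⊓ y) :=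
          mul_le_mul_of_nonneg_right hc (sub_nonneg.2 inf_le_left)
      _ = algebraMap ℝ A ε * 0 := by rw [mul_sub, h1]; ring
  have h3 := aux_smul_cancel ε hε _ _ h2
  exact (sub_nonpos.1 h3).trans inf_le_right

lemma aux_pow_inf (hfalg : ∀ a b c : A, a ⊓ b = 0 → 0 ≤ c → (c * a) ⊓ b = 0)
    (x y p : A) (hx : 0 ≤ x) (hy : 0 ≤ y) (N : ℕ)
    (h1 : p ≤ x ^ N) (h2 : p ≤ y ^ N) : p ≤ (x ⊓ y) ^ N := by
  have hz : 0 ≤ x ⊓ y := le_inf hx hy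
  have hd : (x - x ⊓ y) ⊓ (y - x ⊓ y) = 0 := by rw [← inf_sub, sub_self]
  have ex := geom_sum₂_mul x (x ⊓ y) N
  have ey := geom_sum₂_mul y (x ⊓ y) N
  have hd1 := hfalg _ _ (∑ i ∈ Finset.range N, x ^ i * (x ⊓ y) ^ (N - 1 - i)) hd
    (Finset.sum_nonneg fun i _ => mul_nonneg (pow_nonneg hx _) (pow_nonneg hz _))
  rw [inf_comm] at hd1
  have hd2 := hfalg _ _ (∑ i ∈ Finset.range N, y ^ i * (x ⊓ y) ^ (N - 1 - i)) hd1
    (Finset.sum_nonneg fun i _ => mul_nonneg (pow_nonneg hy _) (pow_nonneg hz _))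
  rw [ex, ey, ← inf_sub, sub_eq_zero] at hd2
  rw [← hd2]
  exact le_inf h2 h1

/-- Order continuity of multiplication. -/
lemma aux_oc (harch : ∀ f g : A, (∀ n : ℕ, (n : ℝ) • f ≤ g) → f ≤ 0)
    (hsq : ∀ x : A, 0 ≤ x * x)
    (D : Set A) (hD : ∀ d ∈ D, ∀ d' ∈ D, d ⊓ d' ∈ D) (g : A) (hg : IsGLB D g)
    (c p : A) (d0 : A) (hd0 : d0 ∈ D) (h : ∀ d ∈ D, p ≤ c * d) :
    p ≤ c * g := by
  rw [← sub_nonpos]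
  apply aux_arch harch _ (c * c * (d0 - g)) (mul_nonneg (hsq c) (sub_nonneg.2 (hg.1 hd0)))
  intro n
  set ν : A := algebraMap ℝ A ((n : ℝ) + 1) with hν
  set μ : A := algebraMap ℝ A (1 / ((n : ℝ) + 1)) with hμ
  have hνμ : ν * μ = 1 := by
    rw [hν, hμ, ← map_mul]
    have : ((n : ℝ) + 1) * (1 / ((n : ℝ) + 1)) = 1 := by field_simp
    rw [this, map_one]
  have hν0 : 0 ≤ ν := aux_am_nonneg _ (by positivity)
  have hμ0 : 0 ≤ μ := aux_am_nonneg _ (by positivity)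
  have hc0 : 2 * c ≤ ν + μ * (c * c) := by
    have := mul_nonneg hμ0 (hsq (ν - c))
    have e : μ * ((ν - c) * (ν - c)) = (ν + μ * (c * c)) - 2 * c := by
      linear_combination (ν - 2 * c) * hνμ
    rw [e] at this
    exact sub_nonneg.1 this
  -- use c ≤ |..|: multiply by the nonnegative element
  have hlow : (μ * (2 * (p - c * g) - μ * (c * c * (d0 - g))) + g) ∈ lowerBounds D := by
    intro d hd
    have hx : 0 ≤ d ⊓ d0 - g := sub_nonneg.2 (le_inf (hg.1 hd) (hg.1 hd0))
    have h1 : p ≤ c * (d ⊓ d0) := h _ (hD _ hd _ hd0)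
    have h2 : 2 * (p - c * g) ≤ 2 * (c * (d ⊓ d0) - c * g) :=
      mul_le_mul_of_nonneg_left (sub_le_sub_right h1 _) zero_le_two
    have h3 : 2 * (c * (d ⊓ d0) - c * g) ≤ ν * (d - g) + μ * (c * c * (d0 - g)) := by
      calc 2 * (c * (d ⊓ d0) - c * g) = 2 * c * (d ⊓ d0 - g) := by ring
        _ ≤ (ν + μ * (c * c)) * (d ⊓ d0 - g) := mul_le_mul_of_nonneg_right hc0 hx
        _ = ν * (d ⊓ d0 - g) + μ * (c * c) * (d ⊓ d0 - g) := by ring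
        _ ≤ ν * (d - g) + μ * (c * c) * (d0 - g) :=
          add_le_add (mul_le_mul_of_nonneg_left (sub_le_sub_right inf_le_left _) hν0)
            (mul_le_mul_of_nonneg_left (sub_le_sub_right inf_le_right _)
              (mul_nonneg hμ0 (hsq c)))
        _ = _ := by ring
    have h4 : 2 * (p - c * g) - μ * (c * c * (d0 - g)) ≤ ν * (d - g) :=
      sub_le_iff_le_add.2 (h2.trans h3)
    have h5 := mul_le_mul_of_nonneg_left h4 hμ0
    calc _ ≤ μ * (ν * (d - g)) + g := by simpa using h5
      _ = d := by linear_combination (d - g) * hνμ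
  have h6 := hg.2 hlow
  have h7 : μ * (2 * (p - c * g) - μ * (c * c * (d0 - g))) ≤ 0 := by simpa using h6
  have h8 := mul_le_mul_of_nonneg_left h7 hν0
  rw [← mul_assoc, hνμ, one_mul, mul_zero, sub_nonpos] at h8
  have h9 : 0 ≤ μ * (c * c * (d0 - g)) :=
    mul_nonneg hμ0 (mul_nonneg (hsq c) (sub_nonneg.2 (hg.1 hd0)))
  have h10 : 2 * (p - c * g) ≤ 2 * (μ * (c * c * (d0 - g))) := by
    rw [two_mul (μ * _)]; exact h8.trans (le_add_of_nonneg_left h9)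
  apply aux_smul_cancel 2 (by norm_num)
  simpa only [map_ofNat] using h10

/-- Two-term AM-GM. -/
lemma aux_amgm2 (hsq : ∀ x : A, 0 ≤ x * x) (t u : A) (ht : 0 ≤ t) (hu : 0 ≤ u) (n : ℕ) :
    0 ≤ u ^ (n + 1) - (n + 1) * t ^ n * u + n * t ^ (n + 1) := by
  induction n with
  | zero => simp
  | succ n ih =>
    have e : u ^ (n + 1 + 1) - ((n + 1 : ℕ) + 1) * t ^ (n + 1) * u + (n + 1 : ℕ) * t ^ (n + 1 + 1)
      = u * (u ^ (n + 1) - (n + 1) * t ^ n * u + n * t ^ (n + 1))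
        + (n + 1) * t ^ n * ((u - t) * (u - t)) := by push_cast; ring
    rw [e]
    have : (0 : A) ≤ (n : A) + 1 := add_nonneg n.cast_nonneg zero_le_one
    exact add_nonneg (mul_nonneg hu ih)
      (mul_nonneg (mul_nonneg this (pow_nonneg ht _)) (hsq _))

lemma aux_amgm (hsq : ∀ x : A, 0 ≤ x * x) {ι : Type*} (s : Finset ι)
    (y : ι → A) (hy : ∀ i, 0 ≤ y i) :
    (s.card : A) ^ s.card * ∏ i ∈ s, y i ≤ (∑ i ∈ s, y i) ^ s.card := by
  classical
  induction s using Finset.induction_on with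
  | empty => simp
  | insert i s hi ih =>
    rw [Finset.card_insert_of_notMem hi, Finset.prod_insert hi, Finset.sum_insert hi]
    set n := s.card with hn
    set S := ∑ i ∈ s, y i with hS
    set P := ∏ i ∈ s, y i with hP
    have hS0 : 0 ≤ S := Finset.sum_nonneg fun i _ => hy i
    rcases Nat.eq_zero_or_pos n with h0 | hpos
    · have : s = ∅ := by rw [← Finset.card_eq_zero]; omega
      rw [h0]
      simp [hS, hP, this]
    · have hnA : (0 : A) ≤ n := n.cast_nonneg
      have hnA1 : (0 : A) ≤ (n : A) + 1 := add_nonneg hnA zero_le_one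
      have h1 := aux_amgm2 hsq (((n : A) + 1) * S) (n * (y i + S)) (mul_nonneg hnA1 hS0)
        (mul_nonneg hnA (add_nonneg (hy i) hS0)) n
      have e1 : (n * (y i + S)) ^ (n + 1) - (n + 1) * (((n : A) + 1) * S) ^ n * (n * (y i + S))
          + n * (((n : A) + 1) * S) ^ (n + 1)
        = (n : A) ^ (n + 1) * (y i + S) ^ (n + 1)
          - n * ((n : A) + 1) ^ (n + 1) * y i * S ^ n := by
        simp only [mul_pow, pow_succ]; ring
      rw [e1, sub_nonneg] at h1
      have h2 := mul_le_mul_of_nonneg_left ih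
        (mul_nonneg (mul_nonneg hnA (pow_nonneg hnA1 (n + 1))) (hy i))
      have h3 := h2.trans h1
      apply aux_smul_cancel ((n : ℝ) ^ (n + 1)) (by positivity)
      simp only [map_pow, map_natCast]
      calc _ = _ := ?_
        _ ≤ _ := h3
      push_cast
      ring

/-- Approximation lemma: pass from `p ≤ L * |u - r w|` for all `r` to `p ≤ δ L w`. -/
lemma aux_grid (hfalg : ∀ a b c : A, a ⊓ b = 0 → 0 ≤ c → (c * a) ⊓ b = 0)
    (hdist : ∀ x y z : A, x ⊓ (y ⊔ z) = (x ⊓ y) ⊔ (x ⊓ z))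
    (u w L p : A) (huw : u ≤ w) (hu : 0 ≤ u) (hL : 0 ≤ L)
    (h : ∀ r : ℝ, 0 < r → r < 1 → p ≤ L * |u - algebraMap ℝ A r * w|) (M : ℕ) :
    p ≤ algebraMap ℝ A (1 / ((M : ℝ) + 1)) * (L * w) := by
  have hw : 0 ≤ w := hu.trans huw
  set δ : ℝ := 1 / ((M : ℝ) + 1) with hδ
  have hδ0 : 0 < δ := by positivity
  set W : A := algebraMap ℝ A δ * w with hW
  have hW0 : 0 ≤ W := mul_nonneg (aux_am_nonneg _ hδ0.le) hw
  set r : ℕ → ℝ := fun k => (2 * k + 1) / (2 * (M + 1)) with hr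
  set f : ℕ → A := fun k => u - algebraMap ℝ A (r k) * w with hf
  have step : ∀ k, f k = f (k + 1) + W := by
    intro k
    have : r (k + 1) = r k + δ := by simp only [hr, hδ]; push_cast; field_simp; ring
    simp only [hf, hW, this, map_add]; ring
  have claim : ∀ k, k ≤ M → p ≤ L * (W ⊔ f k) := by
    intro k
    induction k with
    | zero =>
      intro _
      refine (h (r 0) (by simp only [hr]; positivity) ?_).trans
        (mul_le_mul_of_nonneg_left ?_ hL)
      · simp only [hr]; rw [div_lt_one (by positivity)]; push_cast; have : (0:ℝ) ≤ M := by positivity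
        linarith
      · apply sup_le
        · exact le_sup_right
        · refine le_trans ?_ le_sup_left
          have : -(u - algebraMap ℝ A (r 0) * w) ≤ algebraMap ℝ A (r 0) * w := by
            rw [neg_sub]; exact sub_le_self _ hu
          refine this.trans ?_
          rw [hW, ← sub_nonneg, ← sub_mul, ← map_sub]
          refine mul_nonneg (aux_am_nonneg _ ?_) hw
          have : δ - r 0 = 1 / (2 * (M + 1)) := by
            simp only [hr, hδ]; push_cast; field_simp; ring
          rw [this]; positivity
    | succ k ih =>
      intro hk
      have h1 := ih (by omega)
      have h2 := h (r (k + 1)) (by simp only [hr]; positivity) (by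
        simp only [hr]; rw [div_lt_one (by positivity)]
        have : ((k + 1 : ℕ) : ℝ) ≤ M := by exact_mod_cast hk
        linarith)
      have h3 := aux_le_mul_inf hfalg L _ _ p hL h1 h2
      refine h3.trans (mul_le_mul_of_nonneg_left ?_ hL)
      change (W ⊔ f k) ⊓ (f (k+1) ⊔ -f (k+1)) ≤ W ⊔ f (k+1)
      rw [hdist]
      apply sup_le
      · exact inf_le_right.trans le_sup_right
      · rw [inf_comm, hdist]
        apply sup_le
        · exact inf_le_right.trans le_sup_left
        · refine le_trans ?_ le_sup_left
          -- (-f) ⊓ (f + W) ≤ W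
          have h5 : 2 * (-f (k+1) ⊓ f k) ≤ 2 * W := by
            calc 2 * (-f (k+1) ⊓ f k) = (-f (k+1) ⊓ f k) + (-f (k+1) ⊓ f k) := two_mul _
              _ ≤ -f (k+1) + f k := add_le_add inf_le_left inf_le_right
              _ = W := by rw [step k]; ring
              _ ≤ 2 * W := by rw [two_mul]; exact le_add_of_nonneg_left hW0
          apply aux_smul_cancel 2 (by norm_num)
          simpa only [map_ofNat] using h5
  refine (claim M le_rfl).trans ?_
  have : L * (W ⊔ f M) ≤ L * W := by
    apply mul_le_mul_of_nonneg_left _ hL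
    apply sup_le le_rfl
    simp only [hf, hW]
    rw [sub_le_iff_le_add, ← add_mul, ← map_add]
    refine huw.trans ?_
    rw [← sub_nonneg]
    have e : algebraMap ℝ A (δ + r M) * w - w = algebraMap ℝ A (δ + r M - 1) * w := by
      rw [map_sub, map_one]; ring
    rw [e]
    refine mul_nonneg (aux_am_nonneg _ ?_) hw
    have : δ + r M - 1 = 1 / (2 * (M + 1)) := by
      simp only [hr, hδ]; field_simp; ring
    rw [this]; positivity
  refine this.trans (le_of_eq ?_)
  rw [hW]; ring

lemma aux_mul_abs (d y : A) : -(|d| * |y|) ≤ d * y := by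
  have h1 : 0 ≤ |d| + d := by rw [← neg_le_iff_add_nonneg]; exact neg_le_abs d
  have h2 : 0 ≤ |d| - d := sub_nonneg.2 (le_abs_self d)
  have h3 : 0 ≤ |y| + y := by rw [← neg_le_iff_add_nonneg]; exact neg_le_abs y
  have h4 : 0 ≤ |y| - y := sub_nonneg.2 (le_abs_self y)
  have h5 := add_nonneg (mul_nonneg h1 h3) (mul_nonneg h2 h4)
  apply aux_smul_cancel 2 (by norm_num)
  rw [← sub_nonneg]
  convert h5 using 1
  simp only [map_ofNat]
  ring

lemma aux_abs_mul_le (x y z : A) (h1 : x ≤ z) (h2 : -x ≤ z) (hz : 0 ≤ z) : y * x ≥ -(|y| * z) := by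
  refine le_trans ?_ (aux_mul_abs y x)
  apply neg_le_neg
  exact mul_le_mul_of_nonneg_left (sup_le h1 h2) (abs_nonneg y)

/-- Substitution of nonnegative elements of `A` into quadratic polynomial inequalities. -/
lemma aux_quad (harch : ∀ f g : A, (∀ n : ℕ, (n : ℝ) • f ≤ g) → f ≤ 0)
    (hfalg : ∀ a b c : A, a ⊓ b = 0 → 0 ≤ c → (c * a) ⊓ b = 0)
    (hdist : ∀ x y z : A, x ⊓ (y ⊔ z) = (x ⊓ y) ⊔ (x ⊓ z))
    (α β γ u c : A) (hu : 0 ≤ u) (hc : 0 ≤ c)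
    (h : ∀ t : ℝ, 0 < t →
      0 ≤ α * algebraMap ℝ A t ^ 2 + β * algebraMap ℝ A t + γ) :
    0 ≤ α * u ^ 2 + β * (u * c) + γ * c ^ 2 := by
  set w := u + c with hw
  have hw0 : 0 ≤ w := add_nonneg hu hc
  have huw : u ≤ w := le_add_of_nonneg_right hc
  set L := 2 * w * (|α| + |β| + |γ|) with hL
  have hL0 : 0 ≤ L := mul_nonneg (mul_nonneg zero_le_two hw0)
    (add_nonneg (add_nonneg (abs_nonneg _) (abs_nonneg _)) (abs_nonneg _))
  rw [← neg_nonpos]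
  apply aux_arch harch _ (L * w) (mul_nonneg hL0 hw0)
  intro M
  refine aux_grid hfalg hdist u w L _ huw hu hL0 ?_ M
  intro r hr0 hr1
  set ρ := algebraMap ℝ A r with hρ
  have hρ0 : 0 ≤ ρ := aux_am_nonneg _ hr0.le
  have hρ1 : 0 ≤ 1 - ρ := by
    have := aux_am_nonneg (A := A) (1 - r) (by linarith)
    rwa [map_sub, map_one] at this
  have hQ : 0 ≤ α * ρ ^ 2 + β * (ρ * (1 - ρ)) + γ * (1 - ρ) ^ 2 := by
    have h1 := mul_nonneg (pow_nonneg hρ1 2) (h (r / (1 - r)) (div_pos hr0 (by linarith)))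
    have e : algebraMap ℝ A (r / (1 - r)) * (1 - ρ) = ρ := by
      rw [hρ, ← map_one (algebraMap ℝ A), ← map_sub, ← map_mul]
      congr 1
      have : 1 - r ≠ 0 := by linarith
      field_simp
    refine h1.trans (le_of_eq ?_)
    generalize algebraMap ℝ A (r / (1 - r)) = τ at e
    linear_combination (α * (τ * (1 - ρ) + ρ) + β * (1 - ρ)) * e
  set d := u - ρ * w with hd
  -- the remainder factor
  set R := α * (u + ρ * w) + β * ((1 - ρ) * w - u) + γ * (-((1 - ρ) * w) - c) with hR
  have e2 : α * u ^ 2 + β * (u * c) + γ * c ^ 2 =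
      w ^ 2 * (α * ρ ^ 2 + β * (ρ * (1 - ρ)) + γ * (1 - ρ) ^ 2) + d * R := by
    have : c = w - u := by rw [hw]; ring
    rw [hR, hd, this]; ring
  have hρw : ρ * w ≤ w := by
    rw [← sub_nonneg]; have := mul_nonneg hρ1 hw0; convert this using 1; ring
  have hρw0 : 0 ≤ ρ * w := mul_nonneg hρ0 hw0
  have hcw : c ≤ w := le_add_of_nonneg_left hu
  have hρ'w0 : 0 ≤ (1 - ρ) * w := mul_nonneg hρ1 hw0
  have hρ'w : (1 - ρ) * w ≤ w := by
    rw [← sub_nonneg]; convert hρw0 using 1; ring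
  have h2w : 0 ≤ 2 * w := mul_nonneg zero_le_two hw0
  have hw2 : w ≤ 2 * w := by rw [two_mul]; exact le_add_of_nonneg_left hw0
  have habs : ∀ a x : A, x ≤ 2 * w → -x ≤ 2 * w → |a * x| ≤ |a| * (2 * w) := by
    intro a x h1 h2
    apply sup_le
    · have := aux_abs_mul_le (-x) a (2 * w) h2 (by rwa [neg_neg]) h2w
      rw [mul_neg] at this
      exact neg_le_neg_iff.1 this
    · have := aux_abs_mul_le x a (2 * w) h1 h2 h2w
      exact neg_le.1 this
  have hRL : |R| ≤ L := by
    have h1 : |α * (u + ρ * w)| ≤ |α| * (2 * w) := by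
      apply habs
      · rw [two_mul]; exact add_le_add huw hρw
      · exact (neg_nonpos.2 (add_nonneg hu hρw0)).trans h2w
    have h2 : |β * ((1 - ρ) * w - u)| ≤ |β| * (2 * w) := by
      apply habs
      · exact (sub_le_self _ hu).trans (hρ'w.trans hw2)
      · rw [neg_sub]; exact (sub_le_self _ hρ'w0).trans (huw.trans hw2)
    have h3 : |γ * (-((1 - ρ) * w) - c)| ≤ |γ| * (2 * w) := by
      apply habs
      · refine le_trans ?_ h2w
        exact sub_nonpos.2 ((neg_nonpos.2 hρ'w0).trans hc)
      · rw [neg_sub, sub_neg_eq_add, two_mul]; exact add_le_add hcw hρ'w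
    refine (abs_add_le _ _).trans ?_
    refine (add_le_add ((abs_add_le _ _).trans (add_le_add h1 h2)) h3).trans (le_of_eq ?_)
    rw [hL]; ring
  rw [e2]
  have h6 : -(d * R) ≤ L * |d| := by
    refine (neg_le.1 (aux_mul_abs d R)).trans ?_
    rw [mul_comm L]
    exact mul_le_mul_of_nonneg_left hRL (abs_nonneg d)
  refine le_trans ?_ h6
  apply neg_le_neg
  exact le_add_of_nonneg_left (mul_nonneg (pow_nonneg hw0 2) hQ)

/-- Main upper estimate. -/
lemma aux_upper (harch : ∀ f g : A, (∀ n : ℕ, (n : ℝ) • f ≤ g) → f ≤ 0)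
    (hfalg : ∀ a b c : A, a ⊓ b = 0 → 0 ≤ c → (c * a) ⊓ b = 0)
    (hdist : ∀ x y z : A, x ⊓ (y ⊔ z) = (x ⊓ y) ⊔ (x ⊓ z))
    {ι : Type*} [DecidableEq ι] (ε : ℝ) (hε : 0 < ε) (b : ι → A) (hb : ∀ i, algebraMap ℝ A ε ≤ b i)
    (g : A) (hg : 0 ≤ g) (s : Finset ι) :
    ∀ (h β : A), 0 ≤ h →
    (∀ σ : ι → ℝ, (∀ i, 0 < σ i) → (s.card + 1) * (g * h) * algebraMap ℝ A (∏ i ∈ s, σ i) ≤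
      h * algebraMap ℝ A (∏ i ∈ s, σ i) * (∑ i ∈ s, algebraMap ℝ A (σ i) * b i) + β) →
    g ^ (s.card + 1) * h ≤ β * ∏ i ∈ s, b i := by
  induction s using Finset.induction_on with
  | empty =>
    intro h β hh H
    have := H (fun _ => 1) (fun _ => one_pos)
    simpa using this
  | insert k s hk ih =>
    intro h β hh H
    rw [Finset.card_insert_of_notMem hk, Finset.prod_insert hk] 
    have := ih (h * g) (β * b k) (mul_nonneg hh hg) ?_
    · calc _ = g ^ (s.card + 1) * (h * g) := by ring
        _ ≤ _ := this
        _ = _ := by ring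
    · intro σ hσ
      set Q := algebraMap ℝ A (∏ i ∈ s, σ i) with hQ
      set S := ∑ i ∈ s, algebraMap ℝ A (σ i) * b i with hS
      have hbk : 0 ≤ b k := (aux_am_nonneg ε hε.le).trans (hb k)
      have q := aux_quad harch hfalg hdist (h * Q * b k)
        (h * Q * S - ((s.card : A) + 1 + 1) * (g * h) * Q) β g (b k) hg hbk ?_
      · apply aux_cancel hfalg ε hε (b k) _ _ (hb k)
        rw [← sub_nonneg]
        convert q using 1
        ring
      · intro t ht
        have H1 := H (Function.update σ k t) (by
          intro i
          by_cases hik : i = k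
          · subst hik; simpa using ht
          · simpa [hik] using hσ i)
        rw [Finset.card_insert_of_notMem hk, Finset.prod_insert hk, Finset.sum_insert hk] at H1
        have e1 : ∏ i ∈ s, Function.update σ k t i = ∏ i ∈ s, σ i := by
          apply Finset.prod_congr rfl
          intro i hi
          rw [Function.update_of_ne]
          rintro rfl; exact hk hi
        have e2 : ∑ i ∈ s, algebraMap ℝ A (Function.update σ k t i) * b i = S := by
          apply Finset.sum_congr rfl
          intro i hi
          rw [Function.update_of_ne]
          rintro rfl; exact hk hi
        rw [e1, e2, Function.update_self, map_mul, ← hQ, ← sub_nonneg] at H1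
        convert H1 using 1
        push_cast
        ring

lemma aux_prod_eps {ι : Type*} (s : Finset ι) (b : ι → A) (hb : ∀ i, 0 ≤ b i) :
    ∃ C : A, 0 ≤ C ∧ ∀ ε : ℝ, 0 ≤ ε → ε ≤ 1 →
      ∏ i ∈ s, (b i + algebraMap ℝ A ε) ≤ ∏ i ∈ s, b i + algebraMap ℝ A ε * C := by
  classical
  induction s using Finset.induction_on with
  | empty => exact ⟨0, le_rfl, by simp⟩
  | insert k s hk ih =>
    obtain ⟨C, hC, h⟩ := ih
    have hP : 0 ≤ ∏ i ∈ s, b i := Finset.prod_nonneg fun i _ => hb i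
    refine ⟨∏ i ∈ s, b i + (b k + 1) * C, add_nonneg hP (mul_nonneg
      (add_nonneg (hb k) zero_le_one) hC), ?_⟩
    intro ε h0 h1
    rw [Finset.prod_insert hk, Finset.prod_insert hk]
    have hE : 0 ≤ algebraMap ℝ A ε := aux_am_nonneg _ h0
    have hE1 : 0 ≤ 1 - algebraMap ℝ A ε := by
      have := aux_am_nonneg (A := A) (1 - ε) (by linarith)
      rwa [map_sub, map_one] at this
    refine (mul_le_mul_of_nonneg_left (h ε h0 h1) (add_nonneg (hb k) hE)).trans ?_
    rw [← sub_nonneg]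
    have := mul_nonneg (mul_nonneg hE hE1) hC
    convert this using 1
    ring

lemma aux_upper' (harch : ∀ f g : A, (∀ n : ℕ, (n : ℝ) • f ≤ g) → f ≤ 0)
    (hfalg : ∀ a b c : A, a ⊓ b = 0 → 0 ≤ c → (c * a) ⊓ b = 0)
    (hdist : ∀ x y z : A, x ⊓ (y ⊔ z) = (x ⊓ y) ⊔ (x ⊓ z))
    {ι : Type*} [DecidableEq ι] [Fintype ι] [Nonempty ι] (b : ι → A) (hb : ∀ i, 0 ≤ b i)
    (g : A) (hg : 0 ≤ g)
    (H : ∀ σ : ι → ℝ, (∀ i, 0 < σ i) → ∏ i, σ i = 1 →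
      (Fintype.card ι : A) * g ≤ ∑ i, algebraMap ℝ A (σ i) * b i) :
    g ^ (Fintype.card ι) ≤ ∏ i, b i := by
  obtain ⟨C, hC, hCb⟩ := aux_prod_eps Finset.univ b hb
  rw [← sub_nonpos]
  apply aux_arch harch _ C hC
  intro n
  set ε : ℝ := 1 / ((n : ℝ) + 1) with hε
  have hε0 : 0 < ε := by positivity
  have hε1 : ε ≤ 1 := by rw [hε, div_le_one (by positivity)]; have : (0:ℝ) ≤ n := by positivity
                         linarith
  rw [sub_le_iff_le_add']
  refine le_trans ?_ (hCb ε hε0.le hε1)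
  have hE : 0 ≤ algebraMap ℝ A ε := aux_am_nonneg _ hε0.le
  obtain ⟨i0⟩ := ‹Nonempty ι›
  have key := aux_upper harch hfalg hdist ε hε0 (fun i => b i + algebraMap ℝ A ε)
    (fun i => le_add_of_nonneg_left (hb i)) g hg (Finset.univ.erase i0) 1
    (b i0 + algebraMap ℝ A ε) zero_le_one ?_
  · have hcard : (Finset.univ.erase i0).card + 1 = Fintype.card ι :=
      Finset.card_erase_add_one (Finset.mem_univ i0)
    rw [hcard, mul_one, Finset.mul_prod_erase Finset.univ (fun i => b i + algebraMap ℝ A ε)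
      (Finset.mem_univ i0)] at key
    exact key
  · intro σ hσ
    have hcard : ((Finset.univ.erase i0).card : A) + 1 = (Fintype.card ι : A) := by
      rw [← Finset.card_univ, ← Finset.card_erase_add_one (Finset.mem_univ i0)]; push_cast; rfl
    rw [hcard]
    set P : ℝ := ∏ i ∈ Finset.univ.erase i0, σ i with hP
    have hP0 : 0 < P := Finset.prod_pos fun i _ => hσ i
    have e1 : ∀ i ∈ Finset.univ.erase i0, Function.update σ i0 P⁻¹ i = σ i := by
      intro i hi
      rw [Function.update_of_ne (Finset.ne_of_mem_erase hi)]
    have H1 := H (Function.update σ i0 P⁻¹) (by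
      intro i
      by_cases hi : i = i0
      · subst hi; simpa using hP0
      · simpa [hi] using hσ i) (by
      rw [← Finset.mul_prod_erase Finset.univ _ (Finset.mem_univ i0), Function.update_self,
        Finset.prod_congr rfl e1, ← hP]
      exact inv_mul_cancel₀ hP0.ne')
    rw [← Finset.add_sum_erase Finset.univ _ (Finset.mem_univ i0), Function.update_self] at H1
    have e2 : ∑ i ∈ Finset.univ.erase i0, algebraMap ℝ A (Function.update σ i0 P⁻¹ i) * b i
        ≤ ∑ i ∈ Finset.univ.erase i0, algebraMap ℝ A (σ i) * (b i + algebraMap ℝ A ε) := by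
      apply Finset.sum_le_sum
      intro i hi
      rw [e1 i hi]
      exact mul_le_mul_of_nonneg_left (le_add_of_nonneg_right hE) (aux_am_nonneg _ (hσ i).le)
    have H2 := H1.trans (add_le_add_right e2 _)
    have H3 := mul_le_mul_of_nonneg_left H2 (aux_am_nonneg (A := A) P hP0.le)
    have e3 : algebraMap ℝ A P * algebraMap ℝ A P⁻¹ = 1 := by
      rw [← map_mul, mul_inv_cancel₀ hP0.ne', map_one]
    generalize (∑ i ∈ Finset.univ.erase i0, algebraMap ℝ A (σ i) * (b i + algebraMap ℝ A ε)) = S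
      at H3
    calc _ = algebraMap ℝ A P * (Fintype.card ι * g) := by ring
      _ ≤ _ := H3
      _ = 1 * algebraMap ℝ A P * S + b i0 := by linear_combination b i0 * e3
      _ ≤ _ := by
        apply add_le_add_right
        exact le_add_of_nonneg_right hE

lemma aux_lower (harch : ∀ f g : A, (∀ n : ℕ, (n : ℝ) • f ≤ g) → f ≤ 0)
    (hfalg : ∀ a b c : A, a ⊓ b = 0 → 0 ≤ c → (c * a) ⊓ b = 0)
    (hsq : ∀ x : A, 0 ≤ x * x)
    (S : Set A) (hS : S.Nonempty) (g : A) (hg : IsGLB S g) (hg0 : 0 ≤ g) (p : A) (N : ℕ)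
    (h : ∀ x ∈ S, p ≤ x ^ N) : p ≤ g ^ N := by
  set D : Set A := {d | g ≤ d ∧ p ≤ d ^ N} with hD
  have hDinf : ∀ d ∈ D, ∀ d' ∈ D, d ⊓ d' ∈ D := by
    rintro d ⟨h1, h2⟩ d' ⟨h3, h4⟩
    exact ⟨le_inf h1 h3, aux_pow_inf hfalg d d' p (hg0.trans h1) (hg0.trans h3) N h2 h4⟩
  have hDg : IsGLB D g := by
    refine ⟨fun d hd => hd.1, fun x hx => hg.2 fun y hy => hx ⟨hg.1 hy, h y hy⟩⟩
  have claim : ∀ j, j ≤ N → ∀ d ∈ D, p ≤ g ^ j * d ^ (N - j) := by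
    intro j
    induction j with
    | zero => intro _ d hd; simpa using hd.2
    | succ j ih =>
      intro hj d0 hd0
      have hd00 : 0 ≤ d0 := hg0.trans hd0.1
      have := aux_oc harch hsq D hDinf g hDg (g ^ j * d0 ^ (N - (j + 1))) p d0 hd0 ?_
      · refine this.trans (le_of_eq (by ring))
      · intro d hd
        have hd1 := hDinf d hd d0 hd0
        have hn := hg0.trans hd1.1
        refine (ih (by omega) _ hd1).trans ?_
        have : N - j = N - (j + 1) + 1 := by omega
        rw [this, pow_succ, ← mul_assoc]
        apply mul_le_mul _ inf_le_left hn (mul_nonneg (pow_nonneg hg0 _) (pow_nonneg hd00 _))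
        exact mul_le_mul_of_nonneg_left (pow_le_pow_left₀ hn inf_le_right _) (pow_nonneg hg0 _)
  obtain ⟨x, hx⟩ := hS
  simpa using claim N le_rfl x ⟨hg.1 hx, h x hx⟩

end helpers

/-- **Lemma 4.2, second assertion.** In a weighted geometric mean closed Archimedean
`Φ`-algebra `A`, for rational weights `qₖ = mₖ/N` (with `Σ mₖ = N`, `0 < mₖ < N`) and
`a₁, …, aₙ ∈ A⁺`, the weighted geometric mean `△ₖ₌₁ⁿ (aₖ, qₖ)` is nonnegative and its `N`-th
power is `∏ₖ aₖ^{mₖ}`; i.e., `△ₖ₌₁ⁿ (aₖ, qₖ) = ∏ₖ aₖ^{qₖ}`. -/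
theorem stmt12 {A : Type*} [CommRing A] [Lattice A]
    [CovariantClass A A (· + ·) (· ≤ ·)]
    [Algebra ℝ A] [PosSMulMono ℝ A]
    (harch : ∀ f g : A, (∀ n : ℕ, (n : ℝ) • f ≤ g) → f ≤ 0)
    (hmulpos : ∀ a b : A, 0 ≤ a → 0 ≤ b → 0 ≤ a * b)
    (hfalg : ∀ a b c : A, a ⊓ b = 0 → 0 ≤ c → (c * a) ⊓ b = 0)
    (hwgm : ∀ (n : ℕ) (f : Fin n → A) (r : Fin n → ℝ),
      (∀ k, 0 < r k ∧ r k < 1) → (∑ k, r k) = 1 → ∃ m, IsGLB (wSet n f r) m)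
    (n : ℕ) (hn : 1 ≤ n) (N : ℕ) (hN : 0 < N)
    (mv : Fin n → ℕ) (hmv : ∀ k, 0 < mv k ∧ mv k < N)
    (hsum : (∑ k, mv k) = N)
    (a : Fin n → A) (ha : ∀ k, 0 ≤ a k)
    (g : A) (hg : IsGLB (wSet n a (fun k => (mv k : ℝ) / N)) g) :
    0 ≤ g ∧ g ^ N = ∏ k, a k ^ mv k := by
  haveI hoam : IsOrderedAddMonoid A :=
    { add_le_add_left := fun x y h z => by
        rw [add_comm x z, add_comm y z]
        exact CovariantClass.elim z h }
  have hsq : ∀ x : A, 0 ≤ x * x := by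
    intro x
    have h0 : x⁺ ⊓ x⁻ = 0 := posPart_inf_negPart_eq_zero x
    have h1 := hfalg _ _ x⁻ h0 (negPart_nonneg x)
    rw [inf_comm] at h1
    have h2 := hfalg _ _ x⁺ h1 (posPart_nonneg x)
    rw [mul_comm x⁻ x⁺, inf_idem] at h2
    have e : x * x = x⁺ * x⁺ + x⁻ * x⁻ := by
      conv_lhs => rw [← posPart_sub_negPart x]
      linear_combination (-2) * h2
    rw [e]
    exact add_nonneg (hmulpos _ _ (posPart_nonneg x) (posPart_nonneg x))
      (hmulpos _ _ (negPart_nonneg x) (negPart_nonneg x))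
  haveI hor : IsOrderedRing A :=
    { zero_le_one := by simpa using hsq 1
      mul_le_mul_of_nonneg_left := fun c hc x y h => by
        rw [← sub_nonneg, ← mul_sub]; exact hmulpos _ _ hc (sub_nonneg.2 h)
      mul_le_mul_of_nonneg_right := fun c hc x y h => by
        rw [← sub_nonneg, ← sub_mul]; exact hmulpos _ _ (sub_nonneg.2 h) hc }
  have hdist : ∀ x y z : A, x ⊓ (y ⊔ z) = (x ⊓ y) ⊔ (x ⊓ z) := by
    intro x y z
    letI := AddCommGroup.toDistribLattice A
    exact inf_sup_left x y z
  have hN' : (0 : ℝ) < N := by exact_mod_cast hN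
  have habs : ∀ k, |a k| = a k := fun k => abs_of_nonneg (ha k)
  have hg0 : 0 ≤ g := by
    apply hg.2
    rintro x ⟨θ, hθ, -, rfl⟩
    apply Finset.sum_nonneg
    intro k _
    have := hθ k
    exact smul_nonneg (by positivity) (abs_nonneg _)
  refine ⟨hg0, ?_⟩
  have hcard : Fintype.card (Σ k, Fin (mv k)) = N := by
    simp [hsum]
  haveI hne : Nonempty (Σ k, Fin (mv k)) := by
    rw [← Fintype.card_pos_iff, hcard]; exact hN
  have hprod : ∏ i : (Σ k, Fin (mv k)), a i.1 = ∏ k, a k ^ mv k := by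
    rw [Fintype.prod_sigma]; simp
  apply le_antisymm
  · have := aux_upper' harch hfalg hdist (fun i : (Σ k, Fin (mv k)) => a i.1) (fun i => ha i.1)
      g hg0 ?_
    · rwa [hcard, hprod] at this
    · intro σ hσ hσ1
      rw [hcard]
      set θ : Fin n → ℝ := fun k => (∏ j : Fin (mv k), σ ⟨k, j⟩) ^ ((1 : ℝ) / mv k) with hθ
      have hP : ∀ k, 0 < ∏ j : Fin (mv k), σ ⟨k, j⟩ := fun k => Finset.prod_pos fun j _ => hσ _
      have h1 : g ≤ ∑ k, ((mv k : ℝ) / N * θ k) • |a k| := by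
        apply hg.1
        refine ⟨θ, fun k => Real.rpow_pos_of_pos (hP k) _, ?_, rfl⟩
        have : ∀ k, θ k ^ ((mv k : ℝ) / N) = (∏ j : Fin (mv k), σ ⟨k, j⟩) ^ ((1 : ℝ) / N) := by
          intro k
          rw [hθ]
          simp only
          rw [← Real.rpow_mul (hP k).le]
          congr 1
          have : (mv k : ℝ) ≠ 0 := by exact_mod_cast (hmv k).1.ne'
          field_simp
        simp only [this]
        rw [Real.finset_prod_rpow _ _ (fun k _ => (hP k).le)]
        rw [Fintype.prod_sigma] at hσ1
        rw [hσ1, Real.one_rpow]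
      have h2 : ∀ k, (mv k : ℝ) * θ k ≤ ∑ j : Fin (mv k), σ ⟨k, j⟩ := by
        intro k
        have hk : (0 : ℝ) < mv k := by exact_mod_cast (hmv k).1
        have := Real.geom_mean_le_arith_mean Finset.univ (fun _ : Fin (mv k) => (1 : ℝ))
          (fun j => σ ⟨k, j⟩) (fun _ _ => zero_le_one) (by simpa using hk)
          (fun j _ => (hσ _).le)
        simp only [Real.rpow_one, Finset.sum_const, Finset.card_univ, Fintype.card_fin,
          nsmul_eq_mul, mul_one, one_mul] at this
        rw [le_div_iff₀ hk] at this
        rw [hθ]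
        simp only [one_div]
        linarith
      have h3 := mul_le_mul_of_nonneg_left h1 (aux_am_nonneg (A := A) N hN'.le)
      rw [map_natCast] at h3
      refine h3.trans ?_
      rw [Fintype.sum_sigma, Finset.mul_sum]
      apply Finset.sum_le_sum
      intro k _
      simp only
      rw [← Finset.sum_mul, ← map_sum, habs, Algebra.smul_def, ← mul_assoc,
        ← map_natCast (algebraMap ℝ A), ← map_mul]
      apply mul_le_mul_of_nonneg_right _ (ha k)
      rw [← sub_nonneg, ← map_sub]
      apply aux_am_nonneg
      have : (N : ℝ) * ((mv k : ℝ) / N * θ k) = mv k * θ k := by field_simp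
      rw [this]
      linarith [h2 k]
  · apply aux_lower harch hfalg hsq _ _ g hg hg0
    · rintro x ⟨θ, hθ, hθ1, rfl⟩
      have hy : ∀ i : (Σ k, Fin (mv k)), 0 ≤ algebraMap ℝ A (θ i.1) * a i.1 := fun i =>
        mul_nonneg (aux_am_nonneg _ (hθ _).le) (ha _)
      have h1 := aux_amgm hsq Finset.univ (fun i : (Σ k, Fin (mv k)) =>
        algebraMap ℝ A (θ i.1) * a i.1) hy
      rw [Finset.card_univ, hcard, Finset.prod_mul_distrib, hprod, ← map_prod] at h1
      have e1 : ∏ i : (Σ k, Fin (mv k)), θ i.1 = 1 := by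
        rw [Fintype.prod_sigma]
        simp only [Finset.prod_const, Finset.card_univ, Fintype.card_fin]
        have : ∀ k, θ k ^ mv k = (θ k ^ ((mv k : ℝ) / N)) ^ N := by
          intro k
          rw [← Real.rpow_natCast (_ ^ _), ← Real.rpow_mul (hθ k).le, ← Real.rpow_natCast]
          congr 1
          field_simp
        simp only [this]
        rw [Finset.prod_pow, hθ1, one_pow]
      have e2 : ∑ i : (Σ k, Fin (mv k)), algebraMap ℝ A (θ i.1) * a i.1
          = algebraMap ℝ A N * ∑ k, ((mv k : ℝ) / N * θ k) • |a k| := by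
        rw [Fintype.sum_sigma, Finset.mul_sum]
        apply Finset.sum_congr rfl
        intro k _
        simp only [Finset.sum_const, Finset.card_univ, Fintype.card_fin, nsmul_eq_mul]
        rw [habs, Algebra.smul_def, ← mul_assoc, ← mul_assoc, ← map_mul,
          ← map_natCast (algebraMap ℝ A), ← map_mul]
        congr 2
        field_simp
      rw [e1, e2, map_one, one_mul, mul_pow, ← map_natCast (algebraMap ℝ A), ← map_pow] at h1
      exact aux_smul_cancel _ (by positivity) _ _ h1
    · exact ⟨_, fun _ => 1, fun _ => one_pos, by simp, rfl⟩
end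

section
/- Let A be a weighted geometric mean closed Archimedean Φ-algebra and let p, q ∈ (0,∞). Then for every a ∈ A⁺, (a^p)^q = a^{p·q}, where all real powers are defined via the infimum formula. -/
/-- The set whose infimum gives the fractional part of the real power `a^r` in a
`Φ`-algebra with unit `1`: with `r̃ = r - ⌊r⌋`, this is
`{ r̃·θ₁·a + (1-r̃)·θ₂·e : θ₁, θ₂ ∈ (0,∞), θ₁^{r̃}·θ₂^{1-r̃} = 1 }`. -/
def rpowSet {A : Type*} [CommRing A] [Lattice A] [Module ℝ A]
    (a : A) (r : ℝ) : Set A :=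
  {x | ∃ θ₁ θ₂ : ℝ, 0 < θ₁ ∧ 0 < θ₂ ∧
      θ₁ ^ (r - (⌊r⌋₊ : ℝ)) * θ₂ ^ (1 - (r - (⌊r⌋₊ : ℝ))) = 1 ∧
      x = ((r - (⌊r⌋₊ : ℝ)) * θ₁) • a + ((1 - (r - (⌊r⌋₊ : ℝ))) * θ₂) • (1 : A)}

/-- `IsRPow a r b` says that `b = a^r` in the sense of Definition 4.3:
`a^r = a^{⌊r⌋} · inf (rpowSet a r)` (with `a^{⌊r⌋} = e` when `⌊r⌋ = 0`). -/
def IsRPow {A : Type*} [CommRing A] [Lattice A] [Module ℝ A]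
    (a : A) (r : ℝ) (b : A) : Prop :=
  ∃ c : A, IsGLB (rpowSet a r) c ∧ b = a ^ ⌊r⌋₊ * c

/-- A total, multiplicatively closed, proper cone, playing the role of the nonnegative elements
of a totally ordered quotient. -/
structure PCone {A : Type*} [CommRing A] [Lattice A] (T : Set A) : Prop where
  nonneg : ∀ u, 0 ≤ u → u ∈ T
  add : ∀ u v, u ∈ T → v ∈ T → u + v ∈ T
  mul : ∀ u v, u ∈ T → v ∈ T → u * v ∈ T
  inf : ∀ u v, u ∈ T → v ∈ T → u ⊓ v ∈ T
  total : ∀ u, u ∈ T ∨ -u ∈ T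
  proper : (-1 : A) ∉ T

theorem exists_kill {R : Type*} [CommRing R] [IsReduced R] {P : Ideal R}
    (hP : P ∈ (⊥ : Ideal R).minimalPrimes) {x : R} (hx : x ∈ P) : ∃ y ∉ P, x * y = 0 := by
  have hPp : P.IsPrime := hP.1.1
  by_contra! hcon
  have hd : Disjoint ((⊥ : Ideal R) : Set R) (Submonoid.powers x ⊔ P.primeCompl : Submonoid R) := by
    rw [Set.disjoint_left]
    intro z hz hzS
    have hz0 : z = 0 := by simpa using hz
    subst hz0
    obtain ⟨u, ⟨n, rfl⟩, v, hv, huv⟩ := Submonoid.mem_sup.1 hzS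
    have hv' : v ∉ P := hv
    apply hcon v hv'
    have h1 : (x * v) ^ (n + 1) = 0 := by
      have : (x * v) ^ (n + 1) = (x ^ n * v) * (x * v ^ n) := by ring
      rw [this]
      simp only at huv
      rw [huv, zero_mul]
    exact pow_eq_zero_iff (n.succ_ne_zero) |>.1 h1
  obtain ⟨Q, hQ, -, hQd⟩ := Ideal.exists_le_prime_disjoint _ _ hd
  rw [Set.disjoint_left] at hQd
  have hQP : Q ≤ P := by
    intro z hz
    by_contra hzP
    exact hQd hz (Submonoid.mem_sup_right (show z ∈ P.primeCompl from hzP))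
  have := hP.2 ⟨hQ, bot_le⟩ hQP
  exact hQd (this hx) (Submonoid.mem_sup_left (Submonoid.mem_powers x))

section order
variable {A : Type*} [CommRing A] [Lattice A] [IsOrderedRing A]

theorem exists_cone [IsReduced A] (hdisj : ∀ u v : A, u ⊓ v = 0 → u * v = 0)
    (hsq : ∀ u : A, 0 ≤ u * u) (x : A) (hx : ¬ 0 ≤ x) : ∃ T : Set A, PCone T ∧ x ∉ T := by
  set w0 : A := -(x ⊓ 0) with hw0
  have hw0n : 0 ≤ w0 := by rw [hw0, neg_nonneg]; exact inf_le_right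
  have hw0z : w0 ≠ 0 := by
    intro h
    apply hx
    have : x ⊓ 0 = 0 := by simpa [hw0] using h
    exact inf_eq_right.1 this
  have hex : ∃ P ∈ (⊥ : Ideal A).minimalPrimes, w0 ∉ P := by
    by_contra! hcon
    have h1 : w0 ∈ sInf (⊥ : Ideal A).minimalPrimes := by
      rw [Ideal.mem_sInf]; intro I hI; exact hcon I hI
    rw [Ideal.sInf_minimalPrimes] at h1
    obtain ⟨n, hn⟩ := h1
    exact hw0z (eq_zero_of_pow_eq_zero (n := n) (by simpa using hn))
  obtain ⟨P, hP, hwP⟩ := hex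
  have hPp : P.IsPrime := hP.1.1
  have kill : ∀ u ∈ P, ∃ w ∉ P, 0 ≤ w ∧ w * u = 0 := by
    intro u hu
    obtain ⟨y, hy, hxy⟩ := exists_kill hP hu
    refine ⟨y * y, ?_, hsq y, ?_⟩
    · intro h; rcases hPp.mem_or_mem h with h | h <;> exact hy h
    · rw [mul_assoc, mul_comm y u, hxy, mul_zero]
  have hmulP : ∀ u v, u ∉ P → v ∉ P → u * v ∉ P := by
    intro u v hu hv h; rcases hPp.mem_or_mem h with h | h
    exacts [hu h, hv h]
  have h1P : (1 : A) ∉ P := fun h => hPp.ne_top ((Ideal.eq_top_iff_one P).2 h)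
  have hinf : ∀ u v : A, (∃ w ∉ P, 0 ≤ w ∧ 0 ≤ w * u) → (∃ w ∉ P, 0 ≤ w ∧ 0 ≤ w * v) →
      (∃ w ∉ P, 0 ≤ w ∧ 0 ≤ w * (u ⊓ v)) := by
    rintro u v ⟨w1, hw1, hw1n, h1⟩ ⟨w2, hw2, hw2n, h2⟩
    have h0 : (u - u ⊓ v) ⊓ (v - u ⊓ v) = 0 := by
      apply le_antisymm
      · have : u ⊓ v ≤ u ⊓ v := le_rfl
        have h3 : (u - u ⊓ v) ⊓ (v - u ⊓ v) + u ⊓ v ≤ u ⊓ v := by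
          apply le_inf
          · have := add_le_add_left (inf_le_left : (u - u ⊓ v) ⊓ (v - u ⊓ v) ≤ _) (u ⊓ v)
            simpa using this
          · have := add_le_add_left (inf_le_right : (u - u ⊓ v) ⊓ (v - u ⊓ v) ≤ _) (u ⊓ v)
            simpa using this
        exact nonpos_of_add_le_left h3
      · apply le_inf <;> simp
    have h3 := hdisj _ _ h0
    have h4 : (u - u ⊓ v) * (v - u ⊓ v) ∈ P := by rw [h3]; exact P.zero_mem
    rcases hPp.mem_or_mem h4 with h | h
    · obtain ⟨w, hw, hwn, hwe⟩ := kill _ h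
      refine ⟨w * w1, hmulP _ _ hw hw1, mul_nonneg hwn hw1n, ?_⟩
      have : w * w1 * (u ⊓ v) = w * (w1 * u) - w1 * (w * (u - u ⊓ v)) := by ring
      rw [this, hwe, mul_zero, sub_zero]; exact mul_nonneg hwn h1
    · obtain ⟨w, hw, hwn, hwe⟩ := kill _ h
      refine ⟨w * w2, hmulP _ _ hw hw2, mul_nonneg hwn hw2n, ?_⟩
      have : w * w2 * (u ⊓ v) = w * (w2 * v) - w2 * (w * (v - u ⊓ v)) := by ring
      rw [this, hwe, mul_zero, sub_zero]; exact mul_nonneg hwn h2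
  have hbad : ∀ u : A, 0 ≤ u → u ∉ P → ¬ (∃ w ∉ P, 0 ≤ w ∧ 0 ≤ w * (-u)) := by
    rintro u hu huP ⟨w, hw, hwn, h⟩
    have h1 : w * u = 0 := le_antisymm (by simpa using h) (mul_nonneg hwn hu)
    exact hmulP _ _ hw huP (by rw [h1]; exact P.zero_mem)
  refine ⟨{u | ∃ w ∉ P, 0 ≤ w ∧ 0 ≤ w * u}, ⟨?_, ?_, ?_, hinf, ?_, ?_⟩, ?_⟩
  · intro u hu
    exact ⟨1, h1P, zero_le_one, by simpa using hu⟩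
  · rintro u v ⟨w1, hw1, hw1n, h1⟩ ⟨w2, hw2, hw2n, h2⟩
    refine ⟨w1 * w2, hmulP _ _ hw1 hw2, mul_nonneg hw1n hw2n, ?_⟩
    have : w1 * w2 * (u + v) = w2 * (w1 * u) + w1 * (w2 * v) := by ring
    rw [this]; exact add_nonneg (mul_nonneg hw2n h1) (mul_nonneg hw1n h2)
  · rintro u v ⟨w1, hw1, hw1n, h1⟩ ⟨w2, hw2, hw2n, h2⟩
    refine ⟨w1 * w2, hmulP _ _ hw1 hw2, mul_nonneg hw1n hw2n, ?_⟩
    have : w1 * w2 * (u * v) = (w1 * u) * (w2 * v) := by ring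
    rw [this]; exact mul_nonneg h1 h2
  · intro u
    have h0 : (u ⊔ 0) ⊓ ((-u) ⊔ 0) = 0 := posPart_inf_negPart_eq_zero u
    have hd : u = (u ⊔ 0) - ((-u) ⊔ 0) := (posPart_sub_negPart u).symm
    have h4 : (u ⊔ 0) * ((-u) ⊔ 0) ∈ P := by rw [hdisj _ _ h0]; exact P.zero_mem
    rcases hPp.mem_or_mem h4 with h | h
    · right
      obtain ⟨w, hw, hwn, hwe⟩ := kill _ h
      refine ⟨w, hw, hwn, ?_⟩
      have : w * (-u) = w * ((-u) ⊔ 0) - w * (u ⊔ 0) := by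
        conv_lhs => rw [hd]
        ring
      rw [this, hwe, sub_zero]; exact mul_nonneg hwn le_sup_right
    · left
      obtain ⟨w, hw, hwn, hwe⟩ := kill _ h
      refine ⟨w, hw, hwn, ?_⟩
      have : w * u = w * (u ⊔ 0) - w * ((-u) ⊔ 0) := by
        conv_lhs => rw [hd]
        ring
      rw [this, hwe, sub_zero]; exact mul_nonneg hwn le_sup_right
  · exact hbad 1 zero_le_one h1P
  · intro hxT
    have := hinf x 0 hxT ⟨1, h1P, zero_le_one, by simp⟩
    apply hbad w0 hw0n hwP
    simpa [hw0] using this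

end order

section cone
variable {A : Type*} [CommRing A] [Lattice A] [IsOrderedRing A] [Algebra ℝ A] [PosSMulMono ℝ A]

theorem C_nonneg {t : ℝ} (ht : 0 ≤ t) : 0 ≤ algebraMap ℝ A t := by
  rw [Algebra.algebraMap_eq_smul_one]; exact smul_nonneg ht zero_le_one

/-- `u` is infinitesimal with respect to the cone `T`. -/
def Inftl (T : Set A) (u : A) : Prop :=
  ∀ ε : ℝ, 0 < ε → algebraMap ℝ A ε - u ∈ T ∧ algebraMap ℝ A ε + u ∈ T

variable {T : Set A}

set_option linter.unusedSectionVars false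

theorem PCone.C (hT : PCone T) {t : ℝ} (ht : 0 ≤ t) : algebraMap ℝ A t ∈ T :=
  hT.nonneg _ (C_nonneg ht)

theorem PCone.C_iff (hT : PCone T) {t : ℝ} (h : algebraMap ℝ A t ∈ T) : 0 ≤ t := by
  by_contra! hlt
  apply hT.proper
  have h1 := hT.mul _ _ (hT.C (t := (-t)⁻¹) (by rw [inv_nonneg]; linarith)) h
  rw [← map_mul] at h1
  have : (-t)⁻¹ * t = -1 := by
    have : t ≠ 0 := hlt.ne
    field_simp
  rw [this] at h1
  simpa using h1

theorem Inftl.add (hT : PCone T) {u v : A} (hu : Inftl T u) (hv : Inftl T v) :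
    Inftl T (u + v) := by
  intro ε hε
  obtain ⟨h1, h2⟩ := hu (ε / 2) (by positivity)
  obtain ⟨h3, h4⟩ := hv (ε / 2) (by positivity)
  have he : algebraMap ℝ A ε = algebraMap ℝ A (ε / 2) + algebraMap ℝ A (ε / 2) := by
    rw [← map_add]; congr 1; ring
  constructor
  · have := hT.add _ _ h1 h3
    rw [he]; convert this using 1; ring
  · have := hT.add _ _ h2 h4
    rw [he]; convert this using 1; ring

theorem Inftl.neg {u : A} (hu : Inftl T u) : Inftl T (-u) := by
  intro ε hε
  obtain ⟨h1, h2⟩ := hu ε hε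
  exact ⟨by simpa using h2, by simpa [sub_eq_add_neg] using h1⟩

theorem Inftl.smul_pos (hT : PCone T) {u : A} (hu : Inftl T u) {t : ℝ} (ht : 0 ≤ t) :
    Inftl T (algebraMap ℝ A t * u) := by
  intro ε hε
  obtain ⟨h1, h2⟩ := hu (ε / (t + 1)) (by positivity)
  have hC := hT.C ht
  have hr : 0 ≤ ε - t * (ε / (t + 1)) := by
    have : ε - t * (ε / (t + 1)) = ε / (t + 1) := by field_simp; ring
    rw [this]; positivity
  have hD := hT.C hr
  have h3 := hT.add _ _ (hT.mul _ _ hC h1) hD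
  have h4 := hT.add _ _ (hT.mul _ _ hC h2) hD
  rw [map_sub, map_mul] at h3 h4
  constructor
  · convert h3 using 1; ring
  · convert h4 using 1; ring

theorem Inftl.mul (hT : PCone T) {u v : A} (hu : Inftl T u) (hv : Inftl T v) :
    Inftl T (u * v) := by
  intro ε hε
  set δ : ℝ := min 1 (ε / 3) with hδ
  have hδ0 : 0 < δ := by rw [hδ]; positivity
  have hδ1 : 3 * (δ * δ) ≤ ε := by
    have h1 : δ ≤ 1 := min_le_left _ _
    have h2 : δ ≤ ε / 3 := min_le_right _ _
    nlinarith
  obtain ⟨h1, h2⟩ := hu δ hδ0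
  obtain ⟨h3, h4⟩ := hv δ hδ0
  have hC := hT.C hδ0.le
  have hD := hT.C (sub_nonneg.2 hδ1)
  rw [map_sub, map_mul, map_mul] at hD
  have e3 : algebraMap ℝ A 3 = 3 := map_ofNat _ 3
  rw [e3] at hD
  constructor
  · have := hT.add _ _ (hT.add _ _ (hT.mul _ _ h2 h3) (hT.mul _ _ hC (hT.add _ _ h1 h4))) hD
    convert this using 1; ring
  · have := hT.add _ _ (hT.add _ _ (hT.mul _ _ h2 h4) (hT.mul _ _ hC (hT.add _ _ h1 h3))) hD
    convert this using 1; ring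

/-- `x` has standard part `s`. -/
def St (T : Set A) (x : A) (s : ℝ) : Prop := Inftl T (x - algebraMap ℝ A s)

theorem Inftl.zero (hT : PCone T) : Inftl T 0 := by
  intro ε hε
  have := hT.C hε.le
  constructor <;> simpa using this

theorem St.const (hT : PCone T) (s : ℝ) : St T (algebraMap ℝ A s) s := by
  unfold St; rw [sub_self]; exact Inftl.zero hT

theorem St.mul (hT : PCone T) {x y : A} {s t : ℝ} (hs : 0 ≤ s) (ht : 0 ≤ t)
    (hx : St T x s) (hy : St T y t) : St T (x * y) (s * t) := by
  have := Inftl.add hT (Inftl.mul hT hx hy)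
    (Inftl.add hT (Inftl.smul_pos hT hy hs) (Inftl.smul_pos hT hx ht))
  unfold St
  convert this using 1
  rw [map_mul]; ring

theorem St.pow (hT : PCone T) {x : A} {s : ℝ} (hs : 0 ≤ s)
    (hx : St T x s) (n : ℕ) : St T (x ^ n) (s ^ n) := by
  induction n with
  | zero => simpa using St.const hT (1 : ℝ)
  | succ n ih => rw [pow_succ, pow_succ]; exact St.mul hT (pow_nonneg hs n) hs ih hx

theorem St.nonneg (hT : PCone T) {x : A} (hx0 : 0 ≤ x) {s : ℝ} (hx : St T x s) : 0 ≤ s := by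
  apply le_of_forall_pos_le_add
  intro ε hε
  have h1 := hT.add _ _ (hx ε hε).1 (hT.nonneg _ hx0)
  apply hT.C_iff
  rw [map_add]; convert h1 using 1; ring

theorem glb_nonneg {x z : A} (hx0 : 0 ≤ x) {r : ℝ} (hr : 0 ≤ r)
    (hz : IsGLB (rpowSet x r) z) : 0 ≤ z := by
  apply hz.2
  rintro _ ⟨θ₁, θ₂, h1, h2, -, rfl⟩
  have hf := Nat.floor_le hr
  have hf' := Nat.lt_floor_add_one r
  exact add_nonneg (smul_nonneg (mul_nonneg (by linarith) h1.le) hx0)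
    (smul_nonneg (mul_nonneg (by linarith) h2.le) zero_le_one)

theorem rpow_nonneg' {x y : A} (hx0 : 0 ≤ x) {r : ℝ} (hr : 0 ≤ r)
    (hy : IsRPow x r y) : 0 ≤ y := by
  obtain ⟨z, hz, rfl⟩ := hy
  exact mul_nonneg (pow_nonneg hx0 _) (glb_nonneg hx0 hr hz)

theorem St.glb (hT : PCone T) {x z : A} (hx0 : 0 ≤ x) {s r : ℝ} (hr : 0 ≤ r) (hx : St T x s)
    (hz : IsGLB (rpowSet x r) z) : St T z (s ^ (r - (⌊r⌋₊ : ℝ))) := by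
  have hs : 0 ≤ s := hx.nonneg hT hx0
  have hz0 := glb_nonneg hx0 hr hz
  have hf := Nat.floor_le hr
  have hf' := Nat.lt_floor_add_one r
  unfold rpowSet at hz
  set ρ : ℝ := r - (⌊r⌋₊ : ℝ) with hρ
  have hρ0 : 0 ≤ ρ := by linarith
  have hρ1 : ρ < 1 := by linarith
  have mk : ∀ θ₁ θ₂ : ℝ, 0 < θ₁ → 0 < θ₂ → θ₁ ^ ρ * θ₂ ^ (1 - ρ) = 1 →
      z ≤ algebraMap ℝ A (ρ * θ₁) * x + algebraMap ℝ A ((1 - ρ) * θ₂) := by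
    intro θ₁ θ₂ h1 h2 h3
    have := hz.1 ⟨θ₁, θ₂, h1, h2, h3, rfl⟩
    rwa [← Algebra.algebraMap_eq_smul_one, Algebra.smul_def] at this
  rcases hs.eq_or_lt with rfl | hs
  · rcases hρ0.eq_or_lt with h0 | h0
    · -- exponent zero
      rw [← h0] at mk hz ⊢
      have hup := mk 1 1 one_pos one_pos (by simp)
      have hlo : (1 : A) ≤ z := by
        apply hz.2
        rintro _ ⟨θ₁, θ₂, h1, h2, h3, rfl⟩
        have : θ₂ = 1 := by simpa using h3
        simp [this]
      have : z = 1 := le_antisymm (by simpa using hup) hlo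
      rw [this]
      simpa using St.const hT (1 : ℝ)
    · rw [Real.zero_rpow h0.ne']
      intro ε hε
      simp only [map_zero, sub_zero]
      refine ⟨?_, hT.add _ _ (hT.C hε.le) (hT.nonneg _ hz0)⟩
      have hη : 0 < ε / 2 := by positivity
      have h1 := mk ((ε / 2) ^ (-((1 - ρ) / ρ))) (ε / 2) (by positivity) hη (by
        rw [← Real.rpow_mul hη.le, ← Real.rpow_add hη]
        have : -((1 - ρ) / ρ) * ρ + (1 - ρ) = 0 := by field_simp; ring
        rw [this, Real.rpow_zero])
      set K := ρ * (ε / 2) ^ (-((1 - ρ) / ρ)) with hK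
      have hK0 : 0 ≤ K := by rw [hK]; positivity
      have hx' : Inftl T x := by simpa [St] using hx
      have h2 := ((hx'.smul_pos hT hK0) (ε / 2) hη).1
      have h3 : 0 ≤ ε / 2 - (1 - ρ) * (ε / 2) := by nlinarith
      have h4 := hT.add _ _ (hT.add _ _ h2 (hT.C h3)) (hT.nonneg _ (sub_nonneg.2 h1))
      have he : algebraMap ℝ A ε = algebraMap ℝ A (ε / 2) + algebraMap ℝ A (ε / 2) := by
        rw [← map_add]; congr 1; ring
      rw [he]
      rw [map_sub] at h4
      convert h4 using 1; ring
  · have hs1 : s ^ (ρ - 1) * s = s ^ ρ := by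
      rw [← Real.rpow_add_one hs.ne']; congr 1; ring
    have hk : 0 < s ^ (ρ - 1) := by positivity
    have hk' : 0 < s ^ ρ := by positivity
    have hs1' := congrArg (algebraMap ℝ A) hs1
    rw [map_mul] at hs1'
    intro ε hε
    constructor
    · have h1 := mk (s ^ (ρ - 1)) (s ^ ρ) hk hk' (by
        rw [← Real.rpow_mul hs.le, ← Real.rpow_mul hs.le, ← Real.rpow_add hs]
        have : (ρ - 1) * ρ + ρ * (1 - ρ) = 0 := by ring
        rw [this, Real.rpow_zero])
      have h2 := ((Inftl.smul_pos hT hx (mul_nonneg hρ0 hk.le)) ε hε).1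
      have h4 := hT.add _ _ h2 (hT.nonneg _ (sub_nonneg.2 h1))
      convert h4 using 1
      simp only [map_mul, map_sub, map_one, ← hs1']
      ring
    · set l : A := algebraMap ℝ A (s ^ (ρ - 1)) * x ⊓ algebraMap ℝ A (s ^ ρ) with hl
      have hl0 : 0 ≤ l := le_inf (mul_nonneg (C_nonneg hk.le) hx0) (C_nonneg hk'.le)
      have hlz : l ≤ z := by
        apply hz.2
        rintro _ ⟨θ₁, θ₂, h1, h2, h3, rfl⟩
        rw [← Algebra.algebraMap_eq_smul_one, Algebra.smul_def]
        have hA : l ≤ algebraMap ℝ A (s ^ (ρ - 1)) * x := inf_le_left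
        have hB : l ≤ algebraMap ℝ A (s ^ ρ) := inf_le_right
        have c1 : 0 ≤ ρ * (θ₁ * s ^ (1 - ρ)) := by positivity
        have c2 : 0 ≤ (1 - ρ) * (θ₂ * s ^ (-ρ)) :=
          mul_nonneg (by linarith) (by positivity)
        have hA' := mul_le_mul_of_nonneg_left hA (C_nonneg (A := A) c1)
        have hB' := mul_le_mul_of_nonneg_left hB (C_nonneg (A := A) c2)
        have am := Real.geom_mean_le_arith_mean2_weighted hρ0 (by linarith : 0 ≤ 1 - ρ)
          (by positivity : 0 ≤ θ₁ * s ^ (1 - ρ)) (by positivity : 0 ≤ θ₂ * s ^ (-ρ)) (by ring)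
        have hone : (θ₁ * s ^ (1 - ρ)) ^ ρ * (θ₂ * s ^ (-ρ)) ^ (1 - ρ) = 1 := by
          rw [Real.mul_rpow h1.le (by positivity), Real.mul_rpow h2.le (by positivity),
            ← Real.rpow_mul hs.le, ← Real.rpow_mul hs.le]
          have : θ₁ ^ ρ * s ^ ((1 - ρ) * ρ) * (θ₂ ^ (1 - ρ) * s ^ (-ρ * (1 - ρ))) =
            (θ₁ ^ ρ * θ₂ ^ (1 - ρ)) * (s ^ ((1 - ρ) * ρ) * s ^ (-ρ * (1 - ρ))) := by ring
          rw [this, h3, ← Real.rpow_add hs]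
          have : (1 - ρ) * ρ + -ρ * (1 - ρ) = 0 := by ring
          rw [this, Real.rpow_zero, one_mul]
        rw [hone] at am
        have hC := mul_nonneg (C_nonneg (A := A) (sub_nonneg.2 am)) hl0
        rw [← mul_assoc (algebraMap ℝ A _), ← map_mul (algebraMap ℝ A)] at hA'
        rw [← map_mul] at hB'
        have e1 : ρ * (θ₁ * s ^ (1 - ρ)) * s ^ (ρ - 1) = ρ * θ₁ := by
          have : s ^ (1 - ρ) * s ^ (ρ - 1) = 1 := by
            rw [← Real.rpow_add hs]; simp
          linear_combination ρ * θ₁ * this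
        have e2 : (1 - ρ) * (θ₂ * s ^ (-ρ)) * s ^ ρ = (1 - ρ) * θ₂ := by
          have : s ^ (-ρ) * s ^ ρ = 1 := by
            rw [← Real.rpow_add hs]; simp
          linear_combination (1 - ρ) * θ₂ * this
        rw [e1] at hA'
        rw [e2] at hB'
        rw [map_sub, map_add, map_one, sub_mul, add_mul, one_mul] at hC
        exact (sub_nonneg.1 hC).trans (add_le_add hA' hB')
      have h2 := ((Inftl.smul_pos hT hx hk.le) ε hε).2
      have h3 := hT.inf _ _ h2 (hT.C hε.le)
      have h4 := hT.add _ _ h3 (hT.nonneg _ (sub_nonneg.2 hlz))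
      have e : l = ((algebraMap ℝ A ε + algebraMap ℝ A (s ^ (ρ - 1)) * (x - algebraMap ℝ A s)) ⊓
          algebraMap ℝ A ε) + (algebraMap ℝ A (s ^ ρ) - algebraMap ℝ A ε) := by
        rw [hl, inf_add]
        congr 1
        · rw [← hs1']; ring
        · ring
      convert h4 using 1
      conv_rhs => rw [e]
      ring

theorem St.rpow (hT : PCone T) {x y : A} (hx0 : 0 ≤ x) {s r : ℝ} (hr : 0 ≤ r) (hx : St T x s)
    (hy : IsRPow x r y) : St T y (s ^ r) := by
  have hs : 0 ≤ s := hx.nonneg hT hx0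
  obtain ⟨z, hz, rfl⟩ := hy
  have h := St.mul hT (pow_nonneg hs _) (Real.rpow_nonneg hs _) (St.pow hT hs hx ⌊r⌋₊)
    (St.glb hT hx0 hr hx hz)
  have hf := Nat.floor_le hr
  rw [← Real.rpow_natCast, ← Real.rpow_add_of_nonneg hs (by positivity) (by linarith)] at h
  simpa using h

theorem exists_st (hT : PCone T) {x : A} (hx0 : 0 ≤ x) {t₀ : ℝ}
    (ht : x - algebraMap ℝ A t₀ ∉ T) : ∃ s, St T x s := by
  set S : Set ℝ := {t | x - algebraMap ℝ A t ∈ T} with hS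
  have h0 : (0 : ℝ) ∈ S := by simpa [hS] using hT.nonneg _ hx0
  have hb : BddAbove S := by
    refine ⟨t₀, fun t htS => ?_⟩
    have h1 := (hT.total (x - algebraMap ℝ A t₀)).resolve_left ht
    have h2 := hT.add _ _ h1 htS
    have : algebraMap ℝ A (t₀ - t) ∈ T := by
      rw [map_sub]; convert h2 using 1; ring
    linarith [hT.C_iff this]
  refine ⟨sSup S, fun ε hε => ⟨?_, ?_⟩⟩
  · have : sSup S + ε ∉ S := fun h => by linarith [le_csSup hb h]
    have h1 := (hT.total (x - algebraMap ℝ A (sSup S + ε))).resolve_left this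
    convert h1 using 1
    rw [map_add]; ring
  · obtain ⟨t, htS, htl⟩ := exists_lt_of_lt_csSup ⟨0, h0⟩ (by linarith : sSup S - ε < sSup S)
    have h1 := hT.add _ _ htS (hT.C (by linarith : 0 ≤ t - (sSup S - ε)))
    convert h1 using 1
    simp only [map_sub]; ring

theorem key (hT : PCone T) {a c d : A} (ha : 0 ≤ a) (hc : 0 ≤ c) (hd : 0 ≤ d)
    (hst : ∀ s, St T a s → ∃ t, St T c t ∧ St T d t) (n : ℕ) :
    ((c + d) * (1 + a) + 1) - (n : ℝ) • (c - d) ∈ T := by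
  rw [Algebra.smul_def]
  by_cases hfin : ∃ t₀ : ℝ, a - algebraMap ℝ A t₀ ∉ T
  · obtain ⟨t₀, ht₀⟩ := hfin
    obtain ⟨s, hs⟩ := exists_st hT ha ht₀
    obtain ⟨t, h1, h2⟩ := hst s hs
    have h3 : Inftl T (c - d) := by
      have := Inftl.add hT h1 (Inftl.neg h2)
      convert this using 1; ring
    have h4 := ((h3.smul_pos hT (Nat.cast_nonneg n)) 1 one_pos).1
    have h5 : 0 ≤ (c + d) * (1 + a) :=
      mul_nonneg (add_nonneg hc hd) (add_nonneg zero_le_one ha)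
    have h6 := hT.add _ _ h4 (hT.nonneg _ h5)
    convert h6 using 1
    rw [map_one]; ring
  · have h1 : a - algebraMap ℝ A (n : ℝ) ∈ T := by
      by_contra h; exact hfin ⟨_, h⟩
    have hcd := hT.nonneg _ (add_nonneg hc hd)
    have h2 := hT.mul _ _ hcd (hT.add _ _ h1 (hT.nonneg 1 zero_le_one))
    have h3 := hT.mul _ _ (hT.C (Nat.cast_nonneg n)) (hT.nonneg _ (add_nonneg hd hd))
    have h4 := hT.add _ _ (hT.add _ _ h2 h3) (hT.nonneg 1 zero_le_one)
    convert h4 using 1; ring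

end cone

/-- **Lemma 4.5(1).** In a weighted geometric mean closed Archimedean `Φ`-algebra `A`,
for `p, q ∈ (0,∞)` and `a ∈ A⁺` one has `(a^p)^q = a^{p·q}`. -/
theorem stmt14 {A : Type*} [CommRing A] [Lattice A]
    [CovariantClass A A (· + ·) (· ≤ ·)]
    [Algebra ℝ A] [PosSMulMono ℝ A]
    (harch : ∀ f g : A, (∀ n : ℕ, (n : ℝ) • f ≤ g) → f ≤ 0)
    (hmulpos : ∀ a b : A, 0 ≤ a → 0 ≤ b → 0 ≤ a * b)
    (hfalg : ∀ a b c : A, a ⊓ b = 0 → 0 ≤ c → (c * a) ⊓ b = 0)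
    (hwgm : ∀ (n : ℕ) (f : Fin n → A) (r : Fin n → ℝ),
      (∀ k, 0 < r k ∧ r k < 1) → (∑ k, r k) = 1 →
      ∃ m, IsGLB {x | ∃ θ : Fin n → ℝ, (∀ k, 0 < θ k) ∧ (∏ k, θ k ^ r k) = 1 ∧
        x = ∑ k, (r k * θ k) • |f k|} m)
    (p q : ℝ) (hp : 0 < p) (hq : 0 < q)
    (a : A) (ha : 0 ≤ a)
    (b : A) (hb : IsRPow a p b)
    (c : A) (hc : IsRPow b q c)
    (d : A) (hd : IsRPow a (p * q) d) :
    c = d := by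
  have hdisj : ∀ u v : A, u ⊓ v = 0 → u * v = 0 := by
    intro u v h
    have hu : 0 ≤ u := by rw [← h]; exact inf_le_left
    have hv : 0 ≤ v := by rw [← h]; exact inf_le_right
    have h1 := hfalg u v v h hv
    rw [inf_comm] at h1
    have h2 := hfalg _ _ u h1 hu
    rwa [mul_comm v u, inf_idem] at h2
  have : IsOrderedAddMonoid A :=
    { add_le_add_left := fun _ _ h c => by
        first | exact add_le_add_left h c | exact add_le_add_right h c
      add_le_add_right := fun _ _ h c => by
        first | exact add_le_add_left h c | exact add_le_add_right h c }
  have hsq : ∀ u : A, 0 ≤ u * u := by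
    intro u
    have h0 : (u ⊔ 0) ⊓ ((-u) ⊔ 0) = 0 := posPart_inf_negPart_eq_zero u
    have hd : u = (u ⊔ 0) - ((-u) ⊔ 0) := (posPart_sub_negPart u).symm
    have h4 := hdisj _ _ h0
    have : u * u = (u ⊔ 0) * (u ⊔ 0) + ((-u) ⊔ 0) * ((-u) ⊔ 0) := by
      conv_lhs => rw [hd]
      linear_combination (-2 : A) * h4
    rw [this]
    exact add_nonneg (hmulpos _ _ le_sup_right le_sup_right)
      (hmulpos _ _ le_sup_right le_sup_right)
  have : ZeroLEOneClass A := ⟨by simpa using hsq 1⟩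
  have : IsOrderedRing A := IsOrderedRing.of_mul_nonneg (fun u v hu hv => hmulpos u v hu hv)
  have hnil : ∀ u : A, u * u = 0 → u ≤ 0 := by
    intro u hu
    have h2 : u + u ≤ 0 := by
      apply harch _ 1
      intro n
      have := hsq (1 - (n : ℝ) • u)
      have e : (1 - (n : ℝ) • u) * (1 - (n : ℝ) • u) = 1 - (n : ℝ) • (u + u) := by
        simp only [Algebra.smul_def]
        linear_combination (algebraMap ℝ A n) ^ 2 * hu
      rw [e] at this
      exact sub_nonneg.1 this
    have := smul_nonneg (by norm_num : (0 : ℝ) ≤ 1 / 2) (neg_nonneg.2 h2)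
    have e : ((1 / 2 : ℝ)) • (-(u + u)) = -u := by
      rw [← two_smul ℝ u, smul_neg, smul_smul]; norm_num
    rw [e] at this
    exact neg_nonneg.1 this
  have : IsReduced A := by
    rw [isReduced_iff_pow_one_lt 2 one_lt_two]
    intro u hu
    rw [pow_two] at hu
    refine le_antisymm (hnil u hu) ?_
    exact neg_nonpos.1 (hnil (-u) (by simpa using hu))
  have hb0 := rpow_nonneg' ha hp.le hb
  have hc0 := rpow_nonneg' hb0 hq.le hc
  have hd0 := rpow_nonneg' ha (mul_pos hp hq).le hd
  have hst : ∀ T : Set A, PCone T → ∀ s, St T a s → ∃ t, St T c t ∧ St T d t := by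
    intro T hT s hs
    have hs0 := hs.nonneg hT ha
    refine ⟨s ^ (p * q), ?_, St.rpow hT ha (mul_pos hp hq).le hs hd⟩
    rw [Real.rpow_mul hs0]
    exact St.rpow hT hb0 hq.le (St.rpow hT ha hp.le hs hb) hc
  have hle : ∀ c d : A, 0 ≤ c → 0 ≤ d →
      (∀ T : Set A, PCone T → ∀ s, St T a s → ∃ t, St T c t ∧ St T d t) → c ≤ d := by
    intro c d hc0 hd0 hst
    rw [← sub_nonpos]
    apply harch _ ((c + d) * (1 + a) + 1)
    intro n
    rw [← sub_nonneg]
    by_contra hcon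
    obtain ⟨T, hT, hxT⟩ := exists_cone hdisj hsq _ hcon
    exact hxT (key hT ha hc0 hd0 (hst T hT) n)
  refine le_antisymm (hle c d hc0 hd0 hst) (hle d c hd0 hc0 ?_)
  intro T hT s hs
  obtain ⟨t, h1, h2⟩ := hst T hT s hs
  exact ⟨t, h2, h1⟩
end

section
/- (Hölder inequality, Φ-algebra codomain.) Let A and B be weighted geometric mean closed Archimedean Φ-algebras, let n ≥ 1, and let p₁, …, pₙ ∈ (1,∞) satisfy 1/p₁ + ⋯ + 1/pₙ = 1. If T : A → B is a positive linear map, then for all a₁, …, aₙ ∈ A, T( ∏ₖ₌₁ⁿ |aₖ| ) ≤ ∏ₖ₌₁ⁿ ( T(|aₖ|^{pₖ}) )^{1/pₖ}, where the powers |aₖ|^{pₖ} are computed in A and the powers ( · )^{1/pₖ} in B, all via the infimum formula for real powers. -/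
namespace Hol

section pre
variable {A : Type*} [CommRing A] [Lattice A] [CovariantClass A A (· + ·) (· ≤ ·)]

lemma addMon : IsOrderedAddMonoid A where
  add_le_add_left a b h c := by
    have : c + a ≤ c + b := CovariantClass.elim c h
    simpa [add_comm] using this

lemma posneg [IsOrderedAddMonoid A] (hfalg : ∀ a b c : A, a ⊓ b = 0 → 0 ≤ c → (c * a) ⊓ b = 0)
    (x : A) : x⁺ * x⁻ = 0 := by
  have h0 : x⁺ ⊓ x⁻ = 0 := posPart_inf_negPart_eq_zero x
  have h1 := hfalg _ _ x⁻ h0 (negPart_nonneg x)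
  rw [inf_comm] at h1
  have h2 := hfalg _ _ x⁺ h1 (posPart_nonneg x)
  rw [mul_comm x⁻, inf_idem] at h2
  exact h2

lemma mulself [IsOrderedAddMonoid A] (hfalg : ∀ a b c : A, a ⊓ b = 0 → 0 ≤ c → (c * a) ⊓ b = 0)
    (hmul : ∀ a b : A, 0 ≤ a → 0 ≤ b → 0 ≤ a * b)
    (x : A) : 0 ≤ x * x := by
  have h := posneg hfalg x
  have hx : x * x = x⁺ * x⁺ + x⁻ * x⁻ := by
    conv_lhs => rw [← posPart_sub_negPart x]
    linear_combination (-2) * h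
  rw [hx]
  exact add_nonneg (hmul _ _ (posPart_nonneg x) (posPart_nonneg x))
    (hmul _ _ (negPart_nonneg x) (negPart_nonneg x))

lemma ordRing (hfalg : ∀ a b c : A, a ⊓ b = 0 → 0 ≤ c → (c * a) ⊓ b = 0)
    (hmul : ∀ a b : A, 0 ≤ a → 0 ≤ b → 0 ≤ a * b) : IsOrderedRing A := by
  have : IsOrderedAddMonoid A := addMon
  have : ZeroLEOneClass A := ⟨by simpa using mulself hfalg hmul (1 : A)⟩
  exact IsOrderedRing.of_mul_nonneg hmul

end pre

section main
variable {A : Type*} [CommRing A] [Lattice A] [IsOrderedRing A] [Algebra ℝ A] [PosSMulMono ℝ A]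

lemma semiprime (harch : ∀ f g : A, (∀ n : ℕ, (n : ℝ) • f ≤ g) → f ≤ 0)
    (hfalg : ∀ a b c : A, a ⊓ b = 0 → 0 ≤ c → (c * a) ⊓ b = 0)
    (x : A) (hx : 0 ≤ x) (h : x * x = 0) : x = 0 := by
  refine le_antisymm (harch x 1 fun n => ?_) hx
  have h1 := mulself hfalg (fun _ _ => mul_nonneg) (1 - (n : ℝ) • x)
  have h2 : (1 - (n : ℝ) • x) * (1 - (n : ℝ) • x) = 1 - (n : ℝ) • x - (n : ℝ) • x := by
    simp only [sub_mul, mul_sub, smul_mul_smul_comm, h]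
    simp
  rw [h2] at h1
  have h3 : 0 ≤ (n : ℝ) • x := smul_nonneg (by positivity) hx
  calc (n : ℝ) • x ≤ (n : ℝ) • x + (n : ℝ) • x := le_add_of_nonneg_left h3
    _ ≤ 1 := by rw [sub_sub] at h1; exact sub_nonneg.mp h1

lemma localPrinciple (harch : ∀ f g : A, (∀ n : ℕ, (n : ℝ) • f ≤ g) → f ≤ 0)
    (hfalg : ∀ a b c : A, a ⊓ b = 0 → 0 ≤ c → (c * a) ⊓ b = 0)
    (x y : A) (h : ∀ w : A, 0 ≤ w → w ≠ 0 → ∃ q : A, 0 ≤ q ∧ w * q ≠ 0 ∧ w * q * x ≤ w * q * y) :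
    x ≤ y := by
  by_contra hxy
  set g := x - y with hg
  have hgp : g⁺ ≠ 0 := by
    intro h0
    exact hxy (sub_nonpos.mp (posPart_eq_zero.mp h0))
  obtain ⟨q, hq, hne, hle⟩ := h _ (posPart_nonneg g) hgp
  apply hne
  have hpn := posneg hfalg g
  have h1 : g⁺ * q * g = q * (g⁺ * g⁺) := by
    conv_lhs => rw [← posPart_sub_negPart g]
    rw [posPart_sub_negPart g]
    linear_combination (-q) * hpn + g⁺ * q * (posPart_sub_negPart g).symm
  have h2 : q * (g⁺ * g⁺) ≤ 0 := by
    rw [← h1, hg, mul_sub]; exact sub_nonpos.mpr hle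
  have hp := posPart_nonneg g
  have h3 : q * (g⁺ * g⁺) = 0 := le_antisymm h2 (by positivity)
  refine semiprime harch hfalg _ (mul_nonneg hp hq) ?_
  linear_combination q * h3

lemma localize1 (harch : ∀ f g : A, (∀ n : ℕ, (n : ℝ) • f ≤ g) → f ≤ 0)
    (hfalg : ∀ a b c : A, a ⊓ b = 0 → 0 ≤ c → (c * a) ⊓ b = 0)
    (b : A) (hb : 0 ≤ b) (δ : ℝ) (hδ : 0 < δ) (w : A) (hw : 0 ≤ w) (hw0 : w ≠ 0) :
    ∃ q : A, 0 ≤ q ∧ w * q ≠ 0 ∧ ∃ u : ℝ, 0 < u ∧ w * q * b ≤ w * q * (u • 1) ∧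
      w * q * (u • 1) ≤ w * q * (b + δ • 1) := by
  classical
  have hex : ∃ j : ℕ, w * ((j * δ) • (1 : A) - b)⁺ ≠ 0 := by
    by_contra hcon
    push Not at hcon
    apply hw0
    refine le_antisymm (harch w (δ⁻¹ • (w * b)) fun n => ?_) hw
    have h1 : w * (((n : ℝ) * δ) • (1 : A) - b) ≤ 0 := by
      rw [← hcon n]; exact mul_le_mul_of_nonneg_left (le_posPart _) hw
    rw [mul_sub, sub_nonpos] at h1
    have h2 := smul_le_smul_of_nonneg_left h1 (inv_nonneg.mpr hδ.le)
    rw [mul_smul_comm, mul_one, smul_smul] at h2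
    rwa [show δ⁻¹ * ((n : ℝ) * δ) = n by field_simp] at h2
  obtain ⟨j, hj, hmin⟩ : ∃ j : ℕ, w * ((j * δ) • (1 : A) - b)⁺ ≠ 0 ∧
      ∀ i < j, w * ((i * δ) • (1 : A) - b)⁺ = 0 :=
    ⟨Nat.find hex, Nat.find_spec hex, fun i hi => by simpa using Nat.find_min hex hi⟩
  have hj0 : j ≠ 0 := by
    rintro rfl
    apply hj
    have : ((((0 : ℕ) : ℝ) * δ) • (1 : A) - b)⁺ = 0 := by
      rw [posPart_eq_zero]; simpa using hb
    rw [this, mul_zero]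
  obtain ⟨i, rfl⟩ := Nat.exists_eq_succ_of_ne_zero hj0
  have hi := hmin i (Nat.lt_succ_self i)
  set g := (((i.succ : ℕ) : ℝ) * δ) • (1 : A) - b with hg
  have hpn := posneg hfalg g
  have hp := posPart_nonneg g
  refine ⟨g⁺, hp, hj, (i.succ : ℕ) * δ, by positivity, ?_, ?_⟩
  · rw [← sub_nonneg, ← mul_sub, ← hg]
    have : w * g⁺ * g = w * (g⁺ * g⁺) := by
      linear_combination (-w) * hpn + w * g⁺ * (posPart_sub_negPart g).symm
    rw [this]; positivity
  · rw [← sub_nonpos, ← mul_sub]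
    have h3 : (((i.succ : ℕ) : ℝ) * δ) • (1 : A) - (b + δ • 1) = ((i : ℝ) * δ) • (1 : A) - b := by
      rw [Nat.succ_eq_add_one]; push_cast; rw [add_mul, add_smul, one_mul]; abel
    rw [h3]
    calc w * g⁺ * (((i : ℝ) * δ) • (1 : A) - b) ≤ w * g⁺ * (((i : ℝ) * δ) • (1 : A) - b)⁺ :=
          mul_le_mul_of_nonneg_left (le_posPart _) (by positivity)
      _ = 0 := by linear_combination g⁺ * hi

lemma localizeFin (harch : ∀ f g : A, (∀ n : ℕ, (n : ℝ) • f ≤ g) → f ≤ 0)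
    (hfalg : ∀ a b c : A, a ⊓ b = 0 → 0 ≤ c → (c * a) ⊓ b = 0)
    {ι : Type*} (s : Finset ι)
    (b : ι → A) (hb : ∀ k, 0 ≤ b k) (δ : ι → ℝ) (hδ : ∀ k, 0 < δ k)
    (w : A) (hw : 0 ≤ w) (hw0 : w ≠ 0) :
    ∃ q : A, 0 ≤ q ∧ w * q ≠ 0 ∧ ∃ u : ι → ℝ, (∀ k, 0 < u k) ∧
      ∀ k ∈ s, w * q * b k ≤ w * q * (u k • 1) ∧
      w * q * (u k • 1) ≤ w * q * (b k + δ k • 1) := by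
  classical
  induction s using Finset.induction_on with
  | empty => exact ⟨1, zero_le_one, by simpa using hw0, fun _ => 1, fun _ => one_pos, by simp⟩
  | insert i s his ih =>
    obtain ⟨q, hq, hne, u, hu, h⟩ := ih
    obtain ⟨q', hq', hne', v, hv, h1, h2⟩ :=
      localize1 harch hfalg (b i) (hb i) (δ i) (hδ i) (w * q) (mul_nonneg hw hq) hne
    refine ⟨q * q', mul_nonneg hq hq', by rwa [← mul_assoc], Function.update u i v, ?_, ?_⟩
    · intro k
      by_cases hk : k = i
      · subst hk; simpa using hv
      · simpa [hk] using hu k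
    · intro k hk
      rw [← mul_assoc]
      by_cases hki : k = i
      · subst hki; simp only [Function.update_self]; exact ⟨h1, h2⟩
      · have hks : k ∈ s := by simpa [hki] using hk
        have h3 := h k hks
        simp only [Function.update_of_ne hki]
        constructor
        · have := mul_le_mul_of_nonneg_left h3.1 hq'
          calc _ = q' * (w * q * b k) := by ring
            _ ≤ _ := this
            _ = _ := by ring
        · have := mul_le_mul_of_nonneg_left h3.2 hq'
          calc _ = q' * (w * q * (u k • 1)) := by ring
            _ ≤ _ := this
            _ = _ := by ring

lemma mul_inf' (hfalg : ∀ a b c : A, a ⊓ b = 0 → 0 ≤ c → (c * a) ⊓ b = 0)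
    (c x y : A) (hc : 0 ≤ c) : (c * x) ⊓ (c * y) = c * (x ⊓ y) := by
  have h0 : (x - x ⊓ y) ⊓ (y - x ⊓ y) = 0 := by
    rw [← inf_sub]; simp
  have h1 := hfalg _ _ c h0 hc
  rw [inf_comm] at h1
  have h2 := hfalg _ _ c h1 hc
  rw [mul_sub, mul_sub, ← inf_sub, sub_eq_zero, inf_comm] at h2
  exact h2

lemma glb_mul (harch : ∀ f g : A, (∀ n : ℕ, (n : ℝ) • f ≤ g) → f ≤ 0)
    (hfalg : ∀ a b c : A, a ⊓ b = 0 → 0 ≤ c → (c * a) ⊓ b = 0)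
    (S : Set A) (g : A) (hg : IsGLB S g) (hS : S.Nonempty) (c x : A) (hc : 0 ≤ c)
    (h : ∀ y ∈ S, x ≤ c * y) : x ≤ c * g := by
  obtain ⟨y0, hy0⟩ := hS
  have hv0 : 0 ≤ y0 - g := sub_nonneg.mpr (hg.1 hy0)
  rw [← sub_nonpos]
  refine harch _ (c * c * (y0 - g)) fun n => ?_
  rcases Nat.eq_zero_or_pos n with rfl | hn
  · simp only [Nat.cast_zero, zero_smul]; positivity
  have hnr : (0 : ℝ) < n := by exact_mod_cast hn
  -- main estimate
  have key : ∀ y ∈ S, (n : ℝ) • (x - c * g) - c * c * (y0 - g) ≤ ((n : ℝ) * n) • (y - g) := by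
    intro y hy
    have hv : 0 ≤ y - g := sub_nonneg.mpr (hg.1 hy)
    set m := (y - g) ⊓ (y0 - g) with hm
    have hm0 : 0 ≤ m := le_inf hv hv0
    have h1 : x - c * g ≤ c * m := by
      rw [hm, ← mul_inf' hfalg _ _ _ hc]
      refine le_inf ?_ ?_
      · rw [mul_sub]; exact sub_le_sub_right (h y hy) _
      · rw [mul_sub]; exact sub_le_sub_right (h y0 hy0) _
    have h2 : (n : ℝ) • (x - c * g) ≤ (n : ℝ) • (c * m) := smul_le_smul_of_nonneg_left h1 hnr.le
    have h3 : (n : ℝ) • c ≤ ((n : ℝ) * n) • 1 + c * c := by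
      have h4 := mulself hfalg (fun _ _ => mul_nonneg) (c - (n : ℝ) • 1)
      have h5 : (c - (n : ℝ) • 1) * (c - (n : ℝ) • 1) =
          (((n : ℝ) * n) • 1 + c * c) - (n : ℝ) • c - (n : ℝ) • c := by
        simp only [Algebra.smul_def, map_mul]
        ring
      rw [h5] at h4
      have h6 : 0 ≤ (n : ℝ) • c := smul_nonneg hnr.le hc
      calc (n : ℝ) • c ≤ (n : ℝ) • c + (n : ℝ) • c := le_add_of_nonneg_left h6
        _ ≤ _ := by rw [sub_sub] at h4; exact sub_nonneg.mp h4
    have h7 := mul_le_mul_of_nonneg_right h3 hm0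
    rw [sub_le_iff_le_add]
    calc _ ≤ _ := h2
      _ = (n : ℝ) • c * m := by rw [smul_mul_assoc]
      _ ≤ _ := h7
      _ = ((n : ℝ) * n) • m + c * c * m := by rw [add_mul, smul_mul_assoc, one_mul]
      _ ≤ _ := add_le_add (smul_le_smul_of_nonneg_left inf_le_left (by positivity))
        (mul_le_mul_of_nonneg_left inf_le_right (by positivity))
  have hlb : (((n : ℝ) * n)⁻¹ • ((n : ℝ) • (x - c * g) - c * c * (y0 - g)) + g) ∈ lowerBounds S := by
    intro y hy
    have h1 := smul_le_smul_of_nonneg_left (key y hy) (a := ((n : ℝ) * n)⁻¹) (by positivity)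
    rw [inv_smul_smul₀ (by positivity)] at h1
    exact le_sub_iff_add_le.mp h1
  have h1 := hg.2 hlb
  have h2 : ((n : ℝ) * n)⁻¹ • ((n : ℝ) • (x - c * g) - c * c * (y0 - g)) ≤ 0 := by
    simpa using h1
  have h3 := smul_le_smul_of_nonneg_left h2 (a := ((n : ℝ) * n)) (by positivity)
  rw [smul_inv_smul₀ (by positivity), smul_zero] at h3
  exact sub_nonpos.mp h3

lemma glb_prod (harch : ∀ f g : A, (∀ n : ℕ, (n : ℝ) • f ≤ g) → f ≤ 0)
    (hfalg : ∀ a b c : A, a ⊓ b = 0 → 0 ≤ c → (c * a) ⊓ b = 0)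
    {ι : Type*} (s : Finset ι) (S : ι → Set A) (g : ι → A) (hg : ∀ k, IsGLB (S k) (g k))
    (hS : ∀ k, (S k).Nonempty) (hpos : ∀ k, ∀ y ∈ S k, 0 ≤ y) (x : A) :
    ∀ M : A, 0 ≤ M → (∀ y : ι → A, (∀ k, y k ∈ S k) → x ≤ M * ∏ k ∈ s, y k) →
      x ≤ M * ∏ k ∈ s, g k := by
  classical
  have hg0 : ∀ k, 0 ≤ g k := fun k => (hg k).2 (hpos k)
  induction s using Finset.induction_on with
  | empty =>
    intro M hM h
    choose y hy using hS
    simpa using h y hy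
  | insert i s his ih =>
    intro M hM h
    rw [Finset.prod_insert his]
    have h1 : ∀ y ∈ S i, x ≤ (M * ∏ k ∈ s, g k) * y := by
      intro y hy
      have := ih (M * y) (mul_nonneg hM (hpos i y hy)) (fun z hz => by
        have := h (Function.update z i y) (fun k => by
          by_cases hk : k = i
          · subst hk; simpa using hy
          · simpa [hk] using hz k)
        rw [Finset.prod_insert his, Function.update_self,
          Finset.prod_congr rfl (g := z) (fun k hk => by
            rw [Function.update_of_ne]; rintro rfl; exact his hk)] at this
        rwa [mul_assoc])
      calc x ≤ _ := this
        _ = _ := by ring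
    have h2 := glb_mul harch hfalg (S i) (g i) (hg i) (hS i) _ x
      (mul_nonneg hM (Finset.prod_nonneg fun k _ => hg0 k)) h1
    calc x ≤ _ := h2
      _ = _ := by ring

lemma glb_sum {ι : Type*} (s : Finset ι) (S : ι → Set A) (G : ι → A)
    (hS : ∀ k, (S k).Nonempty)
    (hG : ∀ k x, (∀ y ∈ S k, x ≤ y) → x ≤ G k) :
    ∀ x : A, (∀ y : ι → A, (∀ k, y k ∈ S k) → x ≤ ∑ k ∈ s, y k) →
      x ≤ ∑ k ∈ s, G k := by
  classical
  induction s using Finset.induction_on with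
  | empty =>
    intro x h
    choose y hy using hS
    simpa using h y hy
  | insert i s his ih =>
    intro x h
    rw [Finset.sum_insert his, ← sub_le_iff_le_add]
    refine hG i _ fun y hy => ?_
    rw [sub_le_iff_le_add, ← sub_le_iff_le_add']
    refine ih _ fun z hz => ?_
    have := h (Function.update z i y) (fun k => by
          by_cases hk : k = i
          · subst hk; simpa using hy
          · simpa [hk] using hz k)
    rw [Finset.sum_insert his, Function.update_self,
          Finset.sum_congr rfl (g := z) (fun k hk => by
            rw [Function.update_of_ne]; rintro rfl; exact his hk)] at this
    rwa [sub_le_iff_le_add']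

lemma algMap_nonneg {r : ℝ} (hr : 0 ≤ r) : 0 ≤ algebraMap ℝ A r := by
  rw [Algebra.algebraMap_eq_smul_one]; exact smul_nonneg hr zero_le_one

lemma algMap_mono {r s : ℝ} (h : r ≤ s) : algebraMap ℝ A r ≤ algebraMap ℝ A s := by
  rw [← sub_nonneg, ← map_sub]; exact algMap_nonneg (sub_nonneg.mpr h)

lemma loc_mul {v x x' y y' : A} (h1 : v * x ≤ v * x') (h2 : v * y ≤ v * y')
    (hy : 0 ≤ y) (hx' : 0 ≤ x') : v * (x * y) ≤ v * (x' * y') :=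
  calc v * (x * y) = v * x * y := by ring
    _ ≤ v * x' * y := mul_le_mul_of_nonneg_right h1 hy
    _ = v * y * x' := by ring
    _ ≤ v * y' * x' := mul_le_mul_of_nonneg_right h2 hx'
    _ = _ := by ring

lemma loc_prod {ι : Type*} (s : Finset ι) {v : A} {x y : ι → A}
    (h : ∀ k ∈ s, v * x k ≤ v * y k)
    (hx : ∀ k, 0 ≤ x k) (hy : ∀ k, 0 ≤ y k) : v * ∏ k ∈ s, x k ≤ v * ∏ k ∈ s, y k := by
  classical
  induction s using Finset.induction_on with
  | empty => simp
  | insert i s his ih =>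
    rw [Finset.prod_insert his, Finset.prod_insert his]
    exact loc_mul (h i (by simp)) (ih fun k hk => h k (by simp [hk]))
      (Finset.prod_nonneg fun k _ => hx k) (hy i)

lemma loc_pow {v x y : A} (h : v * x ≤ v * y) (hx : 0 ≤ x) (hy : 0 ≤ y) (m : ℕ) :
    v * x ^ m ≤ v * y ^ m := by
  have := loc_prod (Finset.range m) (v := v) (x := fun _ => x) (y := fun _ => y)
    (fun _ _ => h) (fun _ => hx) (fun _ => hy)
  simpa using this

lemma loc_sum {ι : Type*} (s : Finset ι) {v : A} {x y : ι → A}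
    (h : ∀ k ∈ s, v * x k ≤ v * y k) : v * ∑ k ∈ s, x k ≤ v * ∑ k ∈ s, y k := by
  rw [Finset.mul_sum, Finset.mul_sum]; exact Finset.sum_le_sum h

lemma le_of_forall_mul (harch : ∀ f g : A, (∀ n : ℕ, (n : ℝ) • f ≤ g) → f ≤ 0)
    (X Y : A) (hY : 0 ≤ Y) (N : ℕ)
    (h : ∀ d : ℝ, 1 < d → X ≤ algebraMap ℝ A (d ^ N) * Y) : X ≤ Y := by
  rw [← sub_nonpos]
  refine harch _ Y fun n => ?_
  rcases Nat.eq_zero_or_pos n with rfl | hn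
  · simpa using hY
  have hnr : (0 : ℝ) < n := by exact_mod_cast hn
  have hc : (1 : ℝ) < 1 + 1 / n := by simpa using hnr
  have hc' : (1 : ℝ) < (1 + 1 / n : ℝ) ^ (((N + 1 : ℕ) : ℝ)⁻¹) :=
    Real.one_lt_rpow hc (by positivity)
  have hd := h _ hc'
  have hle : ((1 + 1 / n : ℝ) ^ (((N + 1 : ℕ) : ℝ)⁻¹)) ^ N ≤ 1 + 1 / n := by
    calc _ ≤ ((1 + 1 / n : ℝ) ^ (((N + 1 : ℕ) : ℝ)⁻¹)) ^ (N + 1) :=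
          pow_le_pow_right₀ hc'.le (Nat.le_succ N)
      _ = _ := Real.rpow_inv_natCast_pow (by positivity) (Nat.succ_ne_zero N)
  have h2 : X ≤ algebraMap ℝ A (1 + 1 / n) * Y :=
    hd.trans (mul_le_mul_of_nonneg_right (algMap_mono hle) hY)
  have h3 : X - Y ≤ (1 / n : ℝ) • Y := by
    rw [sub_le_iff_le_add, Algebra.smul_def]
    calc X ≤ _ := h2
      _ = _ := by rw [map_add, map_one]; ring
  have h4 := smul_le_smul_of_nonneg_left h3 hnr.le
  rwa [smul_smul, mul_one_div_cancel hnr.ne', one_smul] at h4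

/-- Transfer used for the codomain. -/
lemma geo (harch : ∀ f g : A, (∀ n : ℕ, (n : ℝ) • f ≤ g) → f ≤ 0)
    (hfalg : ∀ a b c : A, a ⊓ b = 0 → 0 ≤ c → (c * a) ⊓ b = 0)
    {ι : Type*} [Fintype ι] (b : ι → A) (hb : ∀ k, 0 ≤ b k) (z : A)
    (α γ : ι → ℝ) (hα : ∀ k, 0 < α k) (hγ : ∀ k, 0 < γ k)
    (h : ∀ u : ι → ℝ, (∀ k, 0 < u k) → ∃ β : ι → ℝ, (∀ k, 0 ≤ β k) ∧ z ≤ ∑ k, β k • b k ∧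
      ∑ k, β k * u k ≤ ∏ k, (α k * u k + γ k)) :
    z ≤ ∏ k, (α k • b k + γ k • 1) := by
  have hl : ∀ k, 0 ≤ α k • b k + γ k • 1 := fun k =>
    add_nonneg (smul_nonneg (hα k).le (hb k)) (smul_nonneg (hγ k).le zero_le_one)
  refine le_of_forall_mul harch _ _ (Finset.prod_nonneg fun k _ => hl k) (Fintype.card ι) ?_
  intro d hd
  refine localPrinciple harch hfalg _ _ fun w hw hw0 => ?_
  obtain ⟨q, hq, hne, u, hu, hloc⟩ := localizeFin harch hfalg Finset.univ b hb
    (fun k => (d - 1) * γ k / α k)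
    (fun k => div_pos (mul_pos (by linarith) (hγ k)) (hα k)) w hw hw0
  refine ⟨q, hq, hne, ?_⟩
  set v := w * q with hv
  have hv0 : 0 ≤ v := mul_nonneg hw hq
  obtain ⟨β, hβ, hz, hβu⟩ := h u hu
  calc v * z ≤ v * ∑ k, β k • b k := mul_le_mul_of_nonneg_left hz hv0
    _ ≤ v * ∑ k, β k • (u k • 1) := by
        refine loc_sum _ fun k hk => ?_
        rw [mul_smul_comm, mul_smul_comm]
        exact smul_le_smul_of_nonneg_left (hloc k hk).1 (hβ k)
    _ = v * algebraMap ℝ A (∑ k, β k * u k) := by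
        simp [Algebra.smul_def, map_sum]
    _ ≤ v * algebraMap ℝ A (∏ k, (α k * u k + γ k)) :=
        mul_le_mul_of_nonneg_left (algMap_mono hβu) hv0
    _ = v * ∏ k, algebraMap ℝ A (α k * u k + γ k) := by rw [map_prod]
    _ ≤ v * ∏ k, (algebraMap ℝ A d * (α k • b k + γ k • 1)) := by
        refine loc_prod _ (fun k hk => ?_)
          (fun k => algMap_nonneg (add_nonneg (mul_pos (hα k) (hu k)).le (hγ k).le))
          (fun k => mul_nonneg (algMap_nonneg (by linarith)) (hl k))
        have h1 := smul_le_smul_of_nonneg_left (hloc k hk).2 (hα k).le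
        calc v * algebraMap ℝ A (α k * u k + γ k)
            = α k • (v * (u k • 1)) + γ k • v := by
              simp only [Algebra.smul_def, map_add, map_mul]; ring
          _ ≤ α k • (v * (b k + ((d - 1) * γ k / α k) • 1)) + γ k • v := by gcongr
          _ = v * (α k • b k + (d * γ k) • 1) := by
              have h2 : d * γ k = α k * ((d - 1) * γ k / α k) + γ k := by
                have := (hα k).ne'
                field_simp; ring
              rw [h2]
              simp only [Algebra.smul_def, map_add, map_mul]; ring
          _ ≤ v * (d • (α k • b k) + (d * γ k) • 1) := by
              refine mul_le_mul_of_nonneg_left (add_le_add_left ?_ _) hv0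
              have h3 : 0 ≤ (d - 1) • (α k • b k) :=
                smul_nonneg (by linarith) (smul_nonneg (hα k).le (hb k))
              rw [sub_smul, one_smul, sub_nonneg] at h3
              exact h3
          _ = _ := by simp only [Algebra.smul_def, map_mul]; ring
    _ = _ := by rw [Finset.prod_mul_distrib, Finset.prod_const, map_pow, Finset.card_univ]

lemma youngτ (harch : ∀ f g : A, (∀ n : ℕ, (n : ℝ) • f ≤ g) → f ≤ 0)
    (hfalg : ∀ a b c : A, a ⊓ b = 0 → 0 ≤ c → (c * a) ⊓ b = 0)
    {ι : Type*} [Fintype ι] (a : ι → A) (τ : ℝ) (hτ : 0 < τ) (ha : ∀ k, τ • 1 ≤ a k)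
    (m : ι → ℕ) (β α γ : ι → ℝ) (hβ : ∀ k, 0 ≤ β k) (hα : ∀ k, 0 ≤ α k) (hγ : ∀ k, 0 ≤ γ k)
    (h : ∀ u : ι → ℝ, (∀ k, 0 < u k) →
      ∏ k, u k ≤ ∑ k, β k * (u k ^ m k * (α k * u k + γ k))) :
    ∏ k, a k ≤ ∑ k, β k • (a k ^ m k * (α k • a k + γ k • 1)) := by
  have ha0 : ∀ k, 0 ≤ a k := fun k => (smul_nonneg hτ.le zero_le_one).trans (ha k)
  have hl : ∀ k, 0 ≤ α k • a k + γ k • 1 := fun k =>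
    add_nonneg (smul_nonneg (hα k) (ha0 k)) (smul_nonneg (hγ k) zero_le_one)
  have hterm : ∀ k, 0 ≤ a k ^ m k * (α k • a k + γ k • 1) := fun k =>
    mul_nonneg (pow_nonneg (ha0 k) _) (hl k)
  refine le_of_forall_mul harch _ _
    (Finset.sum_nonneg fun k _ => smul_nonneg (hβ k) (hterm k)) (∑ k, m k + 1) ?_
  intro d hd
  refine localPrinciple harch hfalg _ _ fun w hw hw0 => ?_
  obtain ⟨q, hq, hne, u, hu, hloc⟩ := localizeFin harch hfalg Finset.univ a ha0
    (fun k => (d - 1) * τ) (fun k => mul_pos (by linarith) hτ) w hw hw0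
  refine ⟨q, hq, hne, ?_⟩
  set v := w * q with hv
  have hv0 : 0 ≤ v := mul_nonneg hw hq
  have hd0 : 0 ≤ d := by linarith
  have hup : ∀ k, v * algebraMap ℝ A (u k) ≤ v * (algebraMap ℝ A d * a k) := by
    intro k
    have h1 := (hloc k (Finset.mem_univ k)).2
    rw [← Algebra.algebraMap_eq_smul_one] at h1
    refine h1.trans (mul_le_mul_of_nonneg_left ?_ hv0)
    have h2 := smul_le_smul_of_nonneg_left (ha k) (a := d - 1) (by linarith)
    calc a k + ((d - 1) * τ) • 1 = a k + (d - 1) • (τ • 1) := by rw [smul_smul]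
      _ ≤ a k + (d - 1) • a k := by gcongr
      _ = _ := by simp only [Algebra.smul_def, map_sub, map_one]; ring
  calc v * ∏ k, a k ≤ v * ∏ k, algebraMap ℝ A (u k) := by
        refine loc_prod _ (fun k hk => ?_) ha0 (fun k => algMap_nonneg (hu k).le)
        have := (hloc k hk).1
        rwa [← Algebra.algebraMap_eq_smul_one] at this
    _ = v * algebraMap ℝ A (∏ k, u k) := by rw [map_prod]
    _ ≤ v * algebraMap ℝ A (∑ k, β k * (u k ^ m k * (α k * u k + γ k))) :=
        mul_le_mul_of_nonneg_left (algMap_mono (h u hu)) hv0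
    _ = v * ∑ k, algebraMap ℝ A (β k * (u k ^ m k * (α k * u k + γ k))) := by rw [map_sum]
    _ ≤ v * ∑ k, algebraMap ℝ A (d ^ (∑ k, m k + 1)) *
          (β k • (a k ^ m k * (α k • a k + γ k • 1))) := by
        refine loc_sum _ fun k _ => ?_
        have hpow := loc_pow (hup k) (algMap_nonneg (hu k).le)
          (mul_nonneg (algMap_nonneg hd0) (ha0 k)) (m k)
        have haff : v * algebraMap ℝ A (α k * u k + γ k) ≤
            v * (algebraMap ℝ A d * (α k • a k + γ k • 1)) := by
          calc v * algebraMap ℝ A (α k * u k + γ k)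
              = α k • (v * algebraMap ℝ A (u k)) + γ k • v := by
                simp only [Algebra.smul_def, map_add, map_mul]; ring
            _ ≤ α k • (v * (algebraMap ℝ A d * a k)) + (d * γ k) • v := by
                refine add_le_add (smul_le_smul_of_nonneg_left (hup k) (hα k)) ?_
                rw [← sub_nonneg, ← sub_smul]
                exact smul_nonneg (by nlinarith [hγ k]) hv0
            _ = _ := by simp only [Algebra.smul_def, map_mul]; ring
        have hprod := loc_mul hpow haff
          (algMap_nonneg (add_nonneg (mul_nonneg (hα k) (hu k).le) (hγ k)))
          (pow_nonneg (mul_nonneg (algMap_nonneg hd0) (ha0 k)) _)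
        have h1 := mul_le_mul_of_nonneg_left hprod (algMap_nonneg (A := A) (hβ k))
        have hdd : d ^ (m k + 1) ≤ d ^ (∑ k, m k + 1) :=
          pow_le_pow_right₀ hd.le (Nat.succ_le_succ
            (Finset.single_le_sum (fun i _ => Nat.zero_le (m i)) (Finset.mem_univ k)))
        calc v * algebraMap ℝ A (β k * (u k ^ m k * (α k * u k + γ k)))
            = algebraMap ℝ A (β k) * (v * (algebraMap ℝ A (u k) ^ m k *
                algebraMap ℝ A (α k * u k + γ k))) := by
              rw [map_mul, map_mul, map_pow]; ring
          _ ≤ _ := h1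
          _ = algebraMap ℝ A (d ^ (m k + 1)) *
              (v * (β k • (a k ^ m k * (α k • a k + γ k • 1)))) := by
              simp only [Algebra.smul_def, mul_pow, map_pow]; ring
          _ ≤ algebraMap ℝ A (d ^ (∑ k, m k + 1)) *
              (v * (β k • (a k ^ m k * (α k • a k + γ k • 1)))) :=
              mul_le_mul_of_nonneg_right (algMap_mono hdd)
                (mul_nonneg hv0 (smul_nonneg (hβ k) (hterm k)))
          _ = _ := by ring
    _ = _ := by rw [← Finset.mul_sum]

lemma pow_shift (a : A) (ha : 0 ≤ a) (m : ℕ) :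
    ∃ C : A, 0 ≤ C ∧ ∀ τ : ℝ, 0 ≤ τ → τ ≤ 1 → (a + τ • 1) ^ m ≤ a ^ m + τ • C := by
  induction m with
  | zero => exact ⟨0, le_rfl, by simp⟩
  | succ m ih =>
    obtain ⟨C, hC, h⟩ := ih
    refine ⟨a ^ m + C * a + C, by positivity, fun τ h0 h1 => ?_⟩
    have hs : (0 : A) ≤ τ • 1 := smul_nonneg h0 zero_le_one
    have h2 := mul_le_mul_of_nonneg_right (h τ h0 h1) (add_nonneg ha hs)
    rw [pow_succ]
    have h3 : (τ * τ) • C ≤ τ • C := by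
      rw [← sub_nonneg, ← sub_smul]; exact smul_nonneg (by nlinarith) hC
    calc _ ≤ _ := h2
      _ = a ^ (m + 1) + τ • (a ^ m + C * a) + (τ * τ) • C := by
        simp only [Algebra.smul_def, map_mul]; ring
      _ ≤ a ^ (m + 1) + τ • (a ^ m + C * a) + τ • C := by gcongr
      _ = _ := by rw [smul_add τ _ C, add_assoc]

lemma young (harch : ∀ f g : A, (∀ n : ℕ, (n : ℝ) • f ≤ g) → f ≤ 0)
    (hfalg : ∀ a b c : A, a ⊓ b = 0 → 0 ≤ c → (c * a) ⊓ b = 0)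
    {ι : Type*} [Fintype ι] (a : ι → A) (ha : ∀ k, 0 ≤ a k)
    (m : ι → ℕ) (β α γ : ι → ℝ) (hβ : ∀ k, 0 ≤ β k) (hα : ∀ k, 0 ≤ α k) (hγ : ∀ k, 0 ≤ γ k)
    (h : ∀ u : ι → ℝ, (∀ k, 0 < u k) →
      ∏ k, u k ≤ ∑ k, β k * (u k ^ m k * (α k * u k + γ k))) :
    ∏ k, a k ≤ ∑ k, β k • (a k ^ m k * (α k • a k + γ k • 1)) := by
  choose C hC hCle using fun k => pow_shift (a k) (ha k) (m k)
  choose D hD hDle using fun k => pow_shift (a k) (ha k) (m k + 1)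
  set E : A := ∑ k, β k • (α k • D k + γ k • C k) with hE
  have hE0 : 0 ≤ E := Finset.sum_nonneg fun k _ => smul_nonneg (hβ k)
    (add_nonneg (smul_nonneg (hα k) (hD k)) (smul_nonneg (hγ k) (hC k)))
  have key : ∀ τ : ℝ, 0 < τ → τ ≤ 1 →
      ∏ k, a k ≤ ∑ k, β k • (a k ^ m k * (α k • a k + γ k • 1)) + τ • E := by
    intro τ h0 h1
    have hs : (0 : A) ≤ τ • 1 := smul_nonneg h0.le zero_le_one
    have hy := youngτ harch hfalg (fun k => a k + τ • 1) τ h0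
      (fun k => le_add_of_nonneg_left (ha k)) m β α γ hβ hα hγ h
    calc ∏ k, a k ≤ ∏ k, (a k + τ • 1) :=
          Finset.prod_le_prod (fun k _ => ha k) (fun k _ => le_add_of_nonneg_right hs)
      _ ≤ _ := hy
      _ ≤ ∑ k, (β k • (a k ^ m k * (α k • a k + γ k • 1)) +
            τ • (β k • (α k • D k + γ k • C k))) := by
          refine Finset.sum_le_sum fun k _ => ?_
          have e1 := smul_le_smul_of_nonneg_left (hDle k τ h0.le h1) (hα k)
          have e2 := smul_le_smul_of_nonneg_left (hCle k τ h0.le h1) (hγ k)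
          have e3 := smul_le_smul_of_nonneg_left (add_le_add e1 e2) (hβ k)
          calc _ = β k • (α k • (a k + τ • 1) ^ (m k + 1) + γ k • (a k + τ • 1) ^ m k) := by
                simp only [Algebra.smul_def]; ring
            _ ≤ _ := e3
            _ = _ := by simp only [Algebra.smul_def]; ring
      _ = _ := by rw [Finset.sum_add_distrib, hE, Finset.smul_sum]
  rw [← sub_nonpos]
  refine harch _ E fun n => ?_
  rcases Nat.eq_zero_or_pos n with rfl | hn
  · simpa using hE0
  have hnr : (1 : ℝ) ≤ n := by exact_mod_cast hn
  have h1 := key (n : ℝ)⁻¹ (by positivity) (inv_le_one_of_one_le₀ hnr)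
  rw [← sub_le_iff_le_add'] at h1
  have h2 := smul_le_smul_of_nonneg_left h1 (a := (n : ℝ)) (by positivity)
  rwa [smul_inv_smul₀ (by positivity)] at h2

lemma affine_ge (f θ₁ θ₂ u : ℝ) (hf0 : 0 ≤ f) (hf1 : f ≤ 1) (h1 : 0 < θ₁) (h2 : 0 < θ₂)
    (h : θ₁ ^ f * θ₂ ^ (1 - f) = 1) (hu : 0 < u) :
    u ^ f ≤ (f * θ₁) * u + (1 - f) * θ₂ := by
  have := Real.geom_mean_le_arith_mean2_weighted hf0 (sub_nonneg.mpr hf1)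
    (mul_pos h1 hu).le h2.le (by ring)
  rw [Real.mul_rpow h1.le hu.le] at this
  calc u ^ f = θ₁ ^ f * u ^ f * θ₂ ^ (1 - f) := by linear_combination (-u ^ f) * h
    _ ≤ _ := this
    _ = _ := by ring

lemma rpowSet_nonempty (a : A) (r : ℝ) : (rpowSet a r).Nonempty :=
  ⟨_, 1, 1, one_pos, one_pos, by simp, rfl⟩

lemma rpowSet_nonneg (a : A) (ha : 0 ≤ a) (r : ℝ) (hr : 0 ≤ r) : ∀ y ∈ rpowSet a r, 0 ≤ y := by
  rintro y ⟨θ₁, θ₂, h1, h2, -, rfl⟩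
  have e1 : 0 ≤ r - (⌊r⌋₊ : ℝ) := sub_nonneg.mpr (Nat.floor_le hr)
  have e2 : 0 ≤ 1 - (r - (⌊r⌋₊ : ℝ)) := by linarith [Nat.lt_floor_add_one r]
  exact add_nonneg (smul_nonneg (mul_nonneg e1 h1.le) ha)
    (smul_nonneg (mul_nonneg e2 h2.le) zero_le_one)

end main
end Hol

/-- **Theorem 4.7(1) (real case), Hölder inequality.** For a positive linear map `T : A → B`
between weighted geometric mean closed Archimedean `Φ`-algebras and conjugate exponents
`p₁, …, pₙ ∈ (1,∞)` with `Σₖ 1/pₖ = 1`,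
`T(∏ₖ |aₖ|) ≤ ∏ₖ (T(|aₖ|^{pₖ}))^{1/pₖ}`; here `cₖ = |aₖ|^{pₖ}` in `A` and
`dₖ = (T cₖ)^{1/pₖ}` in `B`. -/
theorem stmt17 {A : Type*} [CommRing A] [Lattice A]
    [CovariantClass A A (· + ·) (· ≤ ·)]
    [Algebra ℝ A] [PosSMulMono ℝ A]
    {B : Type*} [CommRing B] [Lattice B]
    [CovariantClass B B (· + ·) (· ≤ ·)]
    [Algebra ℝ B] [PosSMulMono ℝ B]
    (harchA : ∀ f g : A, (∀ n : ℕ, (n : ℝ) • f ≤ g) → f ≤ 0)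
    (hmulposA : ∀ a b : A, 0 ≤ a → 0 ≤ b → 0 ≤ a * b)
    (hfalgA : ∀ a b c : A, a ⊓ b = 0 → 0 ≤ c → (c * a) ⊓ b = 0)
    (hwgmA : ∀ (n : ℕ) (f : Fin n → A) (r : Fin n → ℝ),
      (∀ k, 0 < r k ∧ r k < 1) → (∑ k, r k) = 1 →
      ∃ m, IsGLB {x | ∃ θ : Fin n → ℝ, (∀ k, 0 < θ k) ∧ (∏ k, θ k ^ r k) = 1 ∧
        x = ∑ k, (r k * θ k) • |f k|} m)
    (harchB : ∀ f g : B, (∀ n : ℕ, (n : ℝ) • f ≤ g) → f ≤ 0)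
    (hmulposB : ∀ a b : B, 0 ≤ a → 0 ≤ b → 0 ≤ a * b)
    (hfalgB : ∀ a b c : B, a ⊓ b = 0 → 0 ≤ c → (c * a) ⊓ b = 0)
    (hwgmB : ∀ (n : ℕ) (f : Fin n → B) (r : Fin n → ℝ),
      (∀ k, 0 < r k ∧ r k < 1) → (∑ k, r k) = 1 →
      ∃ m, IsGLB {x | ∃ θ : Fin n → ℝ, (∀ k, 0 < θ k) ∧ (∏ k, θ k ^ r k) = 1 ∧
        x = ∑ k, (r k * θ k) • |f k|} m)
    (T : A →ₗ[ℝ] B) (hT : ∀ x : A, 0 ≤ x → 0 ≤ T x)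
    (n : ℕ) (hn : 1 ≤ n)
    (p : Fin n → ℝ) (hp : ∀ k, 1 < p k) (hp1 : (∑ k, (p k)⁻¹) = 1)
    (a : Fin n → A)
    (c : Fin n → A) (hc : ∀ k, IsRPow |a k| (p k) (c k))
    (d : Fin n → B) (hd : ∀ k, IsRPow (T (c k)) (p k)⁻¹ (d k)) :
    T (∏ k, |a k|) ≤ ∏ k, d k := by
  have iA : IsOrderedRing A := Hol.ordRing hfalgA hmulposA
  have iB : IsOrderedRing B := Hol.ordRing hfalgB hmulposB
  have hp0 : ∀ k, 0 < p k := fun k => zero_lt_one.trans (hp k)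
  have habs : ∀ k, 0 ≤ |a k| := fun k => abs_nonneg (a k)
  -- Young inequality in `A`
  have step1 : ∀ θ : Fin n → ℝ, (∀ k, 0 < θ k) → (∏ k, θ k ^ (p k)⁻¹) = 1 →
      ∏ k, |a k| ≤ ∑ k, ((p k)⁻¹ * θ k) • c k := by
    intro θ hθ hθ1
    choose g hg hcg using hc
    have hβ : ∀ k, 0 ≤ (p k)⁻¹ * θ k := fun k => mul_nonneg (inv_nonneg.mpr (hp0 k).le) (hθ k).le
    refine Hol.glb_sum Finset.univ
      (fun k => {y | ∃ x ∈ rpowSet |a k| (p k), y = ((p k)⁻¹ * θ k) • (|a k| ^ ⌊p k⌋₊ * x)})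
      (fun k => ((p k)⁻¹ * θ k) • c k) ?_ ?_ _ ?_
    · intro k
      obtain ⟨x, hx⟩ := Hol.rpowSet_nonempty |a k| (p k)
      exact ⟨_, x, hx, rfl⟩
    · intro k x hx
      have := Hol.glb_mul harchA hfalgA _ _ (hg k) (Hol.rpowSet_nonempty _ _)
        (((p k)⁻¹ * θ k) • |a k| ^ ⌊p k⌋₊) x
        (smul_nonneg (hβ k) (pow_nonneg (habs k) _)) (fun y hy => by
          rw [smul_mul_assoc]; exact hx _ ⟨y, hy, rfl⟩)
      rwa [smul_mul_assoc, ← hcg k] at this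
    · intro y hy
      choose x hx hyx using hy
      choose θ₁ θ₂ h1 h2 h12 hxx using hx
      have e1 : ∀ k, 0 ≤ p k - (⌊p k⌋₊ : ℝ) := fun k => sub_nonneg.mpr (Nat.floor_le (hp0 k).le)
      have e2 : ∀ k, p k - (⌊p k⌋₊ : ℝ) ≤ 1 := fun k => by linarith [Nat.lt_floor_add_one (p k)]
      have := Hol.young harchA hfalgA (fun k => |a k|) habs (fun k => ⌊p k⌋₊)
        (fun k => (p k)⁻¹ * θ k) (fun k => (p k - (⌊p k⌋₊ : ℝ)) * θ₁ k)
        (fun k => (1 - (p k - (⌊p k⌋₊ : ℝ))) * θ₂ k) hβ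
        (fun k => mul_nonneg (e1 k) (h1 k).le)
        (fun k => mul_nonneg (sub_nonneg.mpr (e2 k)) (h2 k).le) (by
          intro u hu
          have am := Real.geom_mean_le_arith_mean_weighted Finset.univ (fun k => (p k)⁻¹)
            (fun k => θ k * u k ^ p k) (fun k _ => inv_nonneg.mpr (hp0 k).le) hp1
            (fun k _ => mul_nonneg (hθ k).le (Real.rpow_nonneg (hu k).le _))
          have e3 : ∏ k, (θ k * u k ^ p k) ^ (p k)⁻¹ = ∏ k, u k := by
            rw [← one_mul (∏ k, u k), ← hθ1, ← Finset.prod_mul_distrib]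
            refine Finset.prod_congr rfl fun k _ => ?_
            rw [Real.mul_rpow (hθ k).le (Real.rpow_nonneg (hu k).le _),
              Real.rpow_rpow_inv (hu k).le (hp0 k).ne']
          rw [← e3]
          refine am.trans (Finset.sum_le_sum fun k _ => ?_)
          rw [← mul_assoc]
          refine mul_le_mul_of_nonneg_left ?_ (hβ k)
          have e4 : u k ^ p k = u k ^ ⌊p k⌋₊ * u k ^ (p k - (⌊p k⌋₊ : ℝ)) := by
            rw [← Real.rpow_natCast, ← Real.rpow_add (hu k)]; congr 1; ring
          rw [e4]
          exact mul_le_mul_of_nonneg_left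
            (Hol.affine_ge _ _ _ _ (e1 k) (e2 k) (h1 k) (h2 k) (h12 k) (hu k))
            (pow_nonneg (hu k).le _))
      refine this.trans (le_of_eq (Finset.sum_congr rfl fun k _ => ?_))
      rw [hyx k, hxx k]
  -- nonnegativity
  have hc0 : ∀ k, 0 ≤ c k := by
    intro k
    obtain ⟨g, hg, hcg⟩ := hc k
    rw [hcg]
    exact mul_nonneg (pow_nonneg (habs k) _)
      (hg.2 (Hol.rpowSet_nonneg _ (habs k) _ (hp0 k).le))
  have hTc : ∀ k, 0 ≤ T (c k) := fun k => hT _ (hc0 k)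
  have step2 : ∀ θ : Fin n → ℝ, (∀ k, 0 < θ k) → (∏ k, θ k ^ (p k)⁻¹) = 1 →
      T (∏ k, |a k|) ≤ ∑ k, ((p k)⁻¹ * θ k) • T (c k) := by
    intro θ hθ hθ1
    have h1 := hT _ (sub_nonneg.mpr (step1 θ hθ hθ1))
    rw [map_sub, sub_nonneg, map_sum] at h1
    simpa only [map_smul] using h1
  -- the codomain
  have hr0 : ∀ k, 0 < (p k)⁻¹ := fun k => inv_pos.mpr (hp0 k)
  have hr1 : ∀ k, (p k)⁻¹ < 1 := fun k => inv_lt_one_of_one_lt₀ (hp k)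
  have hfl : ∀ k, ⌊(p k)⁻¹⌋₊ = 0 := fun k => Nat.floor_eq_zero.mpr (hr1 k)
  have hd' : ∀ k, IsGLB (rpowSet (T (c k)) (p k)⁻¹) (d k) := by
    intro k
    obtain ⟨g, hg, hdg⟩ := hd k
    rw [hfl k, pow_zero, one_mul] at hdg
    rwa [hdg]
  have fin := Hol.glb_prod harchB hfalgB Finset.univ (fun k => rpowSet (T (c k)) (p k)⁻¹) d hd'
    (fun k => Hol.rpowSet_nonempty _ _)
    (fun k => Hol.rpowSet_nonneg _ (hTc k) _ (hr0 k).le) (T (∏ k, |a k|)) 1 zero_le_one (by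
      intro y hy
      rw [one_mul]
      choose θ₁ θ₂ h1 h2 h12 hyy using hy
      simp only [hfl, Nat.cast_zero, sub_zero] at h12 hyy
      have := Hol.geo harchB hfalgB (fun k => T (c k)) hTc (T (∏ k, |a k|))
        (fun k => (p k)⁻¹ * θ₁ k) (fun k => (1 - (p k)⁻¹) * θ₂ k)
        (fun k => mul_pos (hr0 k) (h1 k))
        (fun k => mul_pos (sub_pos.mpr (hr1 k)) (h2 k)) (by
          intro u hu
          set G : ℝ := ∏ k, u k ^ (p k)⁻¹ with hG
          have hG0 : 0 < G := Finset.prod_pos fun k _ => Real.rpow_pos_of_pos (hu k) _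
          have hθ : ∀ k, 0 < G / u k := fun k => div_pos hG0 (hu k)
          refine ⟨fun k => (p k)⁻¹ * (G / u k), fun k => (mul_pos (hr0 k) (hθ k)).le,
            step2 (fun k => G / u k) hθ ?_, ?_⟩
          · calc ∏ k, (G / u k) ^ (p k)⁻¹ = ∏ k, (G ^ (p k)⁻¹ / u k ^ (p k)⁻¹) :=
                  Finset.prod_congr rfl fun k _ => Real.div_rpow hG0.le (hu k).le _
              _ = (∏ k, G ^ (p k)⁻¹) / G := by rw [Finset.prod_div_distrib]
              _ = G / G := by rw [← Real.rpow_sum_of_pos hG0, hp1, Real.rpow_one]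
              _ = 1 := div_self hG0.ne'
          · calc ∑ k, (p k)⁻¹ * (G / u k) * u k = ∑ k, (p k)⁻¹ * G :=
                  Finset.sum_congr rfl fun k _ => by
                    rw [mul_assoc, div_mul_cancel₀ _ (hu k).ne']
              _ = G := by rw [← Finset.sum_mul, hp1, one_mul]
              _ ≤ _ := Finset.prod_le_prod (fun k _ => Real.rpow_nonneg (hu k).le _)
                  (fun k _ => Hol.affine_ge _ _ _ _ (hr0 k).le (hr1 k).le (h1 k) (h2 k)
                    (h12 k) (hu k)))
      refine this.trans (le_of_eq (Finset.prod_congr rfl fun k _ => ?_))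
      rw [hyy k])
  rwa [one_mul] at fin
end

section
/- (Hölder inequality, vector lattice codomain.) Let A be a weighted geometric mean closed Archimedean Φ-algebra, let B be a weighted geometric mean closed Archimedean vector lattice, let n ≥ 1, and let p₁, …, pₙ ∈ (1,∞) satisfy 1/p₁ + ⋯ + 1/pₙ = 1. If T : A → B is a positive linear map, then for all a₁, …, aₙ ∈ A, T( ∏ₖ₌₁ⁿ |aₖ| ) ≤ △ₖ₌₁ⁿ ( T(|aₖ|^{pₖ}), 1/pₖ ), where the powers |aₖ|^{pₖ} are computed in A via the infimum formula for real powers. -/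
theorem hol_core {R : Type*} [CommRing R] [LinearOrder R] [IsStrictOrderedRing R] [Algebra ℝ R]
    (n : ℕ) (p θ : Fin n → ℝ) (hp : ∀ k, 1 < p k) (hp1 : (∑ k, (p k)⁻¹) = 1)
    (hθ : ∀ k, 0 < θ k) (hθ1 : (∏ k, θ k ^ (p k)⁻¹) = 1)
    (a c : Fin n → R) (ha : ∀ k, 0 ≤ a k) (hc0 : ∀ k, 0 ≤ c k)
    (hc : ∀ k, ∀ x : ℝ, 0 < x → algebraMap ℝ R x ≤ a k →
      algebraMap ℝ R (x ^ (p k - (⌊p k⌋₊ : ℝ))) ≤ c k)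
    (ε : ℝ) (hε : 0 < ε) :
    ∏ k, a k < ∑ k, algebraMap ℝ R ((p k)⁻¹ * θ k) * (a k ^ ⌊p k⌋₊ * c k)
      + algebraMap ℝ R ε * (1 + ∑ k, a k ^ (⌊p k⌋₊ + 1)) := by
  have hι0 : ∀ r : ℝ, 0 ≤ r → 0 ≤ algebraMap ℝ R r := by
    intro r hr
    rw [← Real.mul_self_sqrt hr, map_mul]
    exact mul_self_nonneg _
  have hιm : ∀ r s : ℝ, r ≤ s → algebraMap ℝ R r ≤ algebraMap ℝ R s := by
    intro r s h
    have := hι0 (s - r) (by linarith)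
    rw [map_sub] at this
    linarith
  have hιs : ∀ r s : ℝ, r < s → algebraMap ℝ R r < algebraMap ℝ R s := by
    intro r s h
    refine lt_of_le_of_ne (hιm _ _ h.le) fun e => h.ne ?_
    exact (algebraMap ℝ R).injective e
  have hp0 : ∀ k, 0 < p k := fun k => by linarith [hp k]
  have hsum0 : 0 ≤ ∑ k, a k ^ (⌊p k⌋₊ + 1) :=
    Finset.sum_nonneg fun k _ => pow_nonneg (ha k) _
  have hεp : 0 < algebraMap ℝ R ε := by simpa using hιs 0 ε hε
  by_cases hfin : ∀ k, ∃ N : ℝ, a k ≤ algebraMap ℝ R N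
  · -- finite case
    have hst : ∀ k, ∃ x : ℝ, 0 ≤ x ∧ ∀ η : ℝ, 0 < η →
        algebraMap ℝ R (x - η) ≤ a k ∧ a k ≤ algebraMap ℝ R (x + η) := by
      intro k
      obtain ⟨N, hN⟩ := hfin k
      set S : Set ℝ := {r | algebraMap ℝ R r ≤ a k} with hS
      have hbdd : BddAbove S := by
        refine ⟨N, fun r hr => ?_⟩
        by_contra hlt
        have := hιs N r (not_le.mp hlt)
        have hr' : algebraMap ℝ R r ≤ a k := hr
        exact absurd (lt_of_lt_of_le this (hr'.trans hN)) (lt_irrefl _)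
      have h0 : (0 : ℝ) ∈ S := by simpa [hS] using ha k
      refine ⟨sSup S, le_csSup hbdd h0, fun η hη => ⟨?_, ?_⟩⟩
      · obtain ⟨r, hr, hlt⟩ := exists_lt_of_lt_csSup ⟨0, h0⟩ (show sSup S - η < sSup S by linarith)
        exact (hιm _ _ hlt.le).trans hr
      · by_contra hlt
        have : sSup S + η ∈ S := (not_le.mp hlt).le
        have := le_csSup hbdd this
        linarith
    choose x hx0 hx using hst
    have hyoung : ∏ k, x k ≤ ∑ k, (p k)⁻¹ * θ k * (x k) ^ (p k) := by
      have := Real.geom_mean_le_arith_mean_weighted Finset.univ (fun k => (p k)⁻¹)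
        (fun k => θ k * x k ^ p k) (fun k _ => (inv_pos.mpr (hp0 k)).le) hp1
        (fun k _ => mul_nonneg (hθ k).le (Real.rpow_nonneg (hx0 k) _))
      calc ∏ k, x k = ∏ k, (θ k * x k ^ p k) ^ (p k)⁻¹ := by
            have : ∀ k, (θ k * x k ^ p k) ^ (p k)⁻¹ = θ k ^ (p k)⁻¹ * x k := by
              intro k
              rw [Real.mul_rpow (hθ k).le (Real.rpow_nonneg (hx0 k) _),
                Real.rpow_rpow_inv (hx0 k) (hp0 k).ne']
            simp_rw [this]
            rw [Finset.prod_mul_distrib, hθ1, one_mul]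
        _ ≤ _ := this
        _ = _ := by simp_rw [mul_assoc]
    have hcont : Continuous fun η : ℝ =>
        (∑ k, (p k)⁻¹ * θ k * (max (x k - η) 0) ^ (p k)) + ε - ∏ k, (x k + η) := by
      refine Continuous.sub (Continuous.add (continuous_finsetSum _ fun k _ => ?_)
        continuous_const) (by fun_prop)
      exact continuous_const.mul
        (Continuous.rpow_const (by fun_prop) (fun _ => Or.inr (hp0 k).le))
    have hpos0 : 0 < (∑ k, (p k)⁻¹ * θ k * (max (x k - 0) 0) ^ (p k)) + ε - ∏ k, (x k + 0) := by
      have : ∀ k, max (x k - 0) 0 = x k := fun k => by rw [sub_zero, max_eq_left (hx0 k)]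
      simp_rw [this, add_zero]
      linarith
    obtain ⟨δ, hδ, hball⟩ := Metric.eventually_nhds_iff.mp
      (hcont.continuousAt.eventually (lt_mem_nhds hpos0))
    have hη := hball (y := δ / 2) (by
      rw [Real.dist_eq, sub_zero, abs_of_pos (by linarith)]; linarith)
    set η := δ / 2 with hηd
    have hηp : 0 < η := by linarith
    have h1 : ∏ k, a k ≤ algebraMap ℝ R (∏ k, (x k + η)) := by
      rw [map_prod]
      exact Finset.prod_le_prod (fun k _ => ha k) (fun k _ => (hx k η hηp).2)
    have h2 : algebraMap ℝ R (∑ k, (p k)⁻¹ * θ k * (max (x k - η) 0) ^ (p k)) ≤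
        ∑ k, algebraMap ℝ R ((p k)⁻¹ * θ k) * (a k ^ ⌊p k⌋₊ * c k) := by
      rw [map_sum]
      refine Finset.sum_le_sum fun k _ => ?_
      rw [map_mul]
      refine mul_le_mul_of_nonneg_left ?_
        (hι0 _ (mul_nonneg (inv_pos.mpr (hp0 k)).le (hθ k).le))
      rcases le_or_gt (x k - η) 0 with h | h
      · rw [max_eq_right h, Real.zero_rpow (hp0 k).ne', map_zero]
        exact mul_nonneg (pow_nonneg (ha k) _) (hc0 k)
      · rw [max_eq_left h.le]
        have e : (x k - η) ^ p k
            = (x k - η) ^ ⌊p k⌋₊ * (x k - η) ^ (p k - (⌊p k⌋₊ : ℝ)) := by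
          rw [← Real.rpow_natCast, ← Real.rpow_add h]
          congr 1; ring
        rw [e, map_mul, map_pow]
        refine mul_le_mul (pow_le_pow_left₀ (hι0 _ h.le) (hx k η hηp).1 _)
          (hc k _ h (hx k η hηp).1) (hι0 _ (Real.rpow_nonneg h.le _)) (pow_nonneg (ha k) _)
    have h3 := hιs (∏ k, (x k + η))
      ((∑ k, (p k)⁻¹ * θ k * (max (x k - η) 0) ^ (p k)) + ε) (by linarith)
    rw [map_add] at h3
    have h4 := mul_nonneg hεp.le hsum0
    rw [mul_add, mul_one]
    linarith
  · -- infinite case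
    push Not at hfin
    obtain ⟨j, hj⟩ := hfin
    set M := 1 + ∑ k, a k ^ (⌊p k⌋₊ + 1) with hM
    have hM1 : 1 ≤ M := by linarith
    have hMk : ∀ k, a k ^ (⌊p k⌋₊ + 1) ≤ M := by
      intro k
      have := Finset.single_le_sum (f := fun k => a k ^ (⌊p k⌋₊ + 1))
        (fun k _ => pow_nonneg (ha k) _) (Finset.mem_univ k)
      linarith
    have hMinf : ∀ N : ℝ, algebraMap ℝ R N < M := by
      intro N
      refine (hj N).trans_le (le_trans ?_ (hMk j))
      have h1 : 1 ≤ a j := by simpa using (hj 1).le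
      exact le_self_pow₀ h1 (by omega)
    have hS0 : 0 ≤ ∑ k, algebraMap ℝ R ((p k)⁻¹ * θ k) * (a k ^ ⌊p k⌋₊ * c k) :=
      Finset.sum_nonneg fun k _ => mul_nonneg
        (hι0 _ (mul_nonneg (inv_pos.mpr (hp0 k)).le (hθ k).le))
        (mul_nonneg (pow_nonneg (ha k) _) (hc0 k))
    suffices h : ∏ k, a k < algebraMap ℝ R ε * M by linarith
    by_contra hcon
    rw [not_lt] at hcon
    set Q := ∏ k, (⌊p k⌋₊ + 1) with hQ
    have hdvd : ∀ k, (⌊p k⌋₊ + 1) ∣ Q := fun k =>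
      Finset.dvd_prod_of_mem (fun k => ⌊p k⌋₊ + 1) (Finset.mem_univ k)
    have hQpos : 0 < Q := Finset.prod_pos fun k _ => by omega
    have hlt : ∑ k, Q / (⌊p k⌋₊ + 1) < Q := by
      have hr : ((∑ k, Q / (⌊p k⌋₊ + 1) : ℕ) : ℝ) < Q := by
        push_cast
        have : ∀ k, ((Q / (⌊p k⌋₊ + 1) : ℕ) : ℝ) = Q * ((⌊p k⌋₊ : ℝ) + 1)⁻¹ := by
          intro k
          rw [Nat.cast_div (hdvd k) (by positivity), div_eq_mul_inv]
          push_cast; rfl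
        simp_rw [this]
        rw [← Finset.mul_sum]
        have hlt1 : ∑ k, ((⌊p k⌋₊ : ℝ) + 1)⁻¹ < ∑ k, (p k)⁻¹ := by
          refine Finset.sum_lt_sum_of_nonempty ⟨j, Finset.mem_univ j⟩ fun k _ => ?_
          exact inv_strictAnti₀ (hp0 k) (Nat.lt_floor_add_one _)
        rw [hp1] at hlt1
        have : (0 : ℝ) < Q := by exact_mod_cast hQpos
        nlinarith
      exact_mod_cast hr
    have hb : (∏ k, a k) ^ Q ≤ M ^ (Q - 1) := by
      rw [← Finset.prod_pow]
      calc ∏ k, a k ^ Q ≤ ∏ k, M ^ (Q / (⌊p k⌋₊ + 1)) := by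
            refine Finset.prod_le_prod (fun k _ => pow_nonneg (ha k) _) fun k _ => ?_
            conv_lhs => rw [← Nat.mul_div_cancel' (hdvd k), pow_mul]
            exact pow_le_pow_left₀ (pow_nonneg (ha k) _) (hMk k) _
        _ = M ^ ∑ k, Q / (⌊p k⌋₊ + 1) := by rw [Finset.prod_pow_eq_pow_sum]
        _ ≤ M ^ (Q - 1) := pow_le_pow_right₀ hM1 (by omega)
    have hM0 : 0 < M := by linarith
    have hb2 : (algebraMap ℝ R ε * M) ^ Q ≤ M ^ (Q - 1) :=
      (pow_le_pow_left₀ (mul_nonneg hεp.le hM0.le) hcon Q).trans hb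
    have hb3 : (algebraMap ℝ R ε) ^ Q * M * M ^ (Q - 1) ≤ 1 * M ^ (Q - 1) := by
      rw [one_mul, mul_assoc, ← pow_succ', Nat.sub_add_cancel hQpos, ← mul_pow]
      exact hb2
    have hb4 := le_of_mul_le_mul_right hb3 (pow_pos hM0 _)
    have hb5 := mul_lt_mul_of_pos_left (hMinf ((ε ^ Q)⁻¹)) (pow_pos hεp Q)
    rw [← map_pow, ← map_mul, mul_inv_cancel₀ (pow_pos hε Q).ne', map_one, map_pow] at hb5
    exact absurd hb5 (not_lt.mpr hb4)

theorem hol_mul_eq_zero {A : Type*} [CommRing A] [Lattice A]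
    (hfalgA : ∀ a b c : A, a ⊓ b = 0 → 0 ≤ c → (c * a) ⊓ b = 0)
    (a b : A) (h : a ⊓ b = 0) : a * b = 0 := by
  have ha : 0 ≤ a := h ▸ inf_le_left
  have hb : 0 ≤ b := h ▸ inf_le_right
  have h1 := hfalgA a b b h hb
  rw [inf_comm] at h1
  have h2 := hfalgA b (b * a) a h1 ha
  rwa [mul_comm b a, inf_idem] at h2

theorem hol_hom {A : Type*} [CommRing A] [Lattice A]
    [CovariantClass A A (· + ·) (· ≤ ·)] [Algebra ℝ A]
    (hmulposA : ∀ a b : A, 0 ≤ a → 0 ≤ b → 0 ≤ a * b)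
    (hfalgA : ∀ a b c : A, a ⊓ b = 0 → 0 ≤ c → (c * a) ⊓ b = 0)
    (y : A) (hy : ¬ 0 ≤ y) :
    ∃ (I : Ideal A) (_ : LinearOrder (A ⧸ I)) (_ : IsStrictOrderedRing (A ⧸ I)),
      (∀ x : A, 0 ≤ x → 0 ≤ Ideal.Quotient.mk I x) ∧ Ideal.Quotient.mk I y ≤ 0 := by
  have hpn : ∀ x : A, x⁺ * x⁻ = 0 := fun x =>
    hol_mul_eq_zero hfalgA _ _ (posPart_inf_negPart_eq_zero x)
  have hsq : ∀ x : A, 0 ≤ x * x := by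
    intro x
    have e : x * x = x⁺ * x⁺ + x⁻ * x⁻ := by
      have h1 := hpn x
      have h2 := posPart_sub_negPart x
      calc x * x = (x⁺ - x⁻) * (x⁺ - x⁻) := by rw [h2]
        _ = _ := by linear_combination (-2) * h1
    rw [e]
    exact add_nonneg (hmulposA _ _ (posPart_nonneg x) (posPart_nonneg x))
      (hmulposA _ _ (negPart_nonneg x) (negPart_nonneg x))
  have h1 : (0 : A) ≤ 1 := by simpa using hsq 1
  -- the initial preordering
  let P0 : RingPreordering A := RingPreordering.mk'
    {z | ∃ q r : A, 0 ≤ q ∧ 0 ≤ r ∧ z = q - r * y}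
    (by
      rintro _ _ ⟨q, r, hq, hr, rfl⟩ ⟨q', r', hq', hr', rfl⟩
      exact ⟨q + q', r + r', add_nonneg hq hq', add_nonneg hr hr', by ring⟩)
    (by
      rintro _ _ ⟨q, r, hq, hr, rfl⟩ ⟨q', r', hq', hr', rfl⟩
      exact ⟨q * q' + r * r' * (y * y), q * r' + r * q',
        add_nonneg (hmulposA _ _ hq hq') (hmulposA _ _ (hmulposA _ _ hr hr') (hsq y)),
        add_nonneg (hmulposA _ _ hq hr') (hmulposA _ _ hr hq'), by ring⟩)
    (fun x => ⟨x * x, 0, hsq x, le_rfl, by ring⟩)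
    (by
      rintro ⟨q, r, hq, hr, e⟩
      apply hy
      have hy2 := posPart_sub_negPart y
      have e2 : y⁻ + (q * y⁻ + r * (y⁻ * y⁻)) = 0 := by
        have h3 := hpn y
        have : (-1) * y⁻ = (q - r * (y⁺ - y⁻)) * y⁻ := by rw [hy2, ← e]
        linear_combination (-1) * this + r * h3
      have h4 : 0 ≤ q * y⁻ + r * (y⁻ * y⁻) :=
        add_nonneg (hmulposA _ _ hq (negPart_nonneg y)) (hmulposA _ _ hr (hsq _))
      have h5 : y⁻ ≤ 0 := by
        rw [← e2]
        exact le_add_of_nonneg_right h4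
      have h6 : y⁻ = 0 := le_antisymm h5 (negPart_nonneg y)
      rw [← hy2, h6, sub_zero]
      exact posPart_nonneg y)
  have hP0 : ∀ x : A, 0 ≤ x → x ∈ P0 := fun x hx => ⟨x, 0, hx, le_rfl, by ring⟩
  have hP0y : -y ∈ P0 := ⟨0, 1, le_rfl, h1, by ring⟩
  -- maximal preordering
  obtain ⟨P, hP0P, hPmax⟩ : ∃ P : RingPreordering A, P0 ≤ P ∧ ∀ P' : RingPreordering A,
      P ≤ P' → P' ≤ P := by
    obtain ⟨P, h, hm⟩ := zorn_le_nonempty_Ici₀ P0 (by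
      intro C _ hC z hz
      refine ⟨RingPreordering.mk' {x | ∃ Q ∈ C, x ∈ Q} ?_ ?_ ?_ ?_, ?_⟩
      · rintro u v ⟨Q, hQ, hu⟩ ⟨Q', hQ', hv⟩
        rcases hC.total hQ hQ' with h | h
        · exact ⟨Q', hQ', add_mem (h hu) hv⟩
        · exact ⟨Q, hQ, add_mem hu (h hv)⟩
      · rintro u v ⟨Q, hQ, hu⟩ ⟨Q', hQ', hv⟩
        rcases hC.total hQ hQ' with h | h
        · exact ⟨Q', hQ', mul_mem (h hu) hv⟩
        · exact ⟨Q, hQ, mul_mem hu (h hv)⟩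
      · exact fun x => ⟨z, hz, z.mul_self_mem x⟩
      · rintro ⟨Q, _, hu⟩
        exact Q.neg_one_notMem hu
      · intro Q hQ u hu
        exact ⟨Q, hQ, hu⟩) P0 le_rfl
    exact ⟨P, h, fun P' hP' => hm hP'⟩
  have key : ∀ b : A, b ∉ P → ∃ q ∈ P, ∃ r ∈ P, -1 = q + b * r := by
    intro b hb
    by_contra hcon
    apply hb
    have hcon' : (-1 : A) ∉ {z | ∃ q ∈ P, ∃ r ∈ P, z = q + b * r} := hcon
    let P' : RingPreordering A := RingPreordering.mk' {z | ∃ q ∈ P, ∃ r ∈ P, z = q + b * r}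
      (by
        rintro _ _ ⟨q, hq, r, hr, rfl⟩ ⟨q', hq', r', hr', rfl⟩
        exact ⟨q + q', add_mem hq hq', r + r', add_mem hr hr', by ring⟩)
      (by
        rintro _ _ ⟨q, hq, r, hr, rfl⟩ ⟨q', hq', r', hr', rfl⟩
        exact ⟨q * q' + b * b * (r * r'),
          add_mem (mul_mem hq hq') (mul_mem (P.mul_self_mem b) (mul_mem hr hr')),
          q * r' + r * q', add_mem (mul_mem hq hr') (mul_mem hr hq'), by ring⟩)
      (fun x => ⟨x * x, P.mul_self_mem x, 0, zero_mem P, by ring⟩)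
      hcon'
    have hle : P ≤ P' := fun x hx => ⟨x, hx, 0, zero_mem P, by ring⟩
    exact hPmax P' hle ⟨0, zero_mem P, 1, one_mem P, by ring⟩
  have hord : P.IsOrdering := by
    rw [RingPreordering.isOrdering_iff]
    intro a b hab
    by_contra hcon
    rw [not_or] at hcon
    obtain ⟨q, hq, r, hr, e⟩ := key a hcon.1
    obtain ⟨q', hq', r', hr', e'⟩ := key b hcon.2
    apply P.neg_one_notMem
    have : (-1 : A) = -(a * b) * (r * r') + (q + q' + q * q') := by
      linear_combination (1 + q') * e - (a * r) * e'
    rw [this]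
    exact add_mem (mul_mem hab (mul_mem hr hr')) (add_mem (add_mem hq hq') (mul_mem hq hq'))
  have hprime : P.support.IsPrime := inferInstance
  let π := Ideal.Quotient.mk P.support
  have hπ : ∀ x : A, π x ∈ P.toSubsemiring.map π → x ∈ P := by
    rintro x ⟨u, hu, hux⟩
    have := (Ideal.Quotient.eq.mp hux)
    have h2 : -(u - x) ∈ P := this.2
    have h3 : u ∈ P := hu
    have := add_mem h2 h3
    simpa using this
  let C : RingCone (A ⧸ P.support) :=
    { P.toSubsemiring.map π with
      eq_zero_of_mem_of_neg_mem' := by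
        intro x hx hx'
        obtain ⟨x, rfl⟩ := Ideal.Quotient.mk_surjective x
        refine Ideal.Quotient.eq_zero_iff_mem.mpr ⟨hπ x hx, ?_⟩
        apply hπ
        rw [map_neg]
        exact hx' }
  have hCmem : ∀ x ∈ P, π x ∈ C := fun x hx => ⟨x, hx, rfl⟩
  have : HasMemOrNegMem C := ⟨by
    intro x
    obtain ⟨x, rfl⟩ := Ideal.Quotient.mk_surjective x
    rcases mem_or_neg_mem P x with h | h
    · exact Or.inl (hCmem x h)
    · right
      have := hCmem _ h
      rwa [map_neg] at this⟩
  classical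
  let L : LinearOrder (A ⧸ P.support) := LinearOrder.mkOfAddGroupCone C
  have hO : IsOrderedRing (A ⧸ P.support) := IsOrderedRing.mkOfCone C
  have hS : IsStrictOrderedRing (A ⧸ P.support) := IsOrderedRing.toIsStrictOrderedRing _
  refine ⟨P.support, L, hS, fun x hx => ?_, ?_⟩
  · show π x - 0 ∈ C
    rw [sub_zero]
    exact hCmem x (hP0P (hP0 x hx))
  · show 0 - π y ∈ C
    rw [zero_sub, ← map_neg]
    exact hCmem _ (hP0P hP0y)

theorem hol_A {A : Type*} [CommRing A] [Lattice A]
    [CovariantClass A A (· + ·) (· ≤ ·)]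
    [Algebra ℝ A] [PosSMulMono ℝ A]
    (harchA : ∀ f g : A, (∀ n : ℕ, (n : ℝ) • f ≤ g) → f ≤ 0)
    (hmulposA : ∀ a b : A, 0 ≤ a → 0 ≤ b → 0 ≤ a * b)
    (hfalgA : ∀ a b c : A, a ⊓ b = 0 → 0 ≤ c → (c * a) ⊓ b = 0)
    (n : ℕ) (p θ : Fin n → ℝ) (hp : ∀ k, 1 < p k) (hp1 : (∑ k, (p k)⁻¹) = 1)
    (hθ : ∀ k, 0 < θ k) (hθ1 : (∏ k, θ k ^ (p k)⁻¹) = 1)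
    (a c : Fin n → A) (ha : ∀ k, 0 ≤ a k) (hc : ∀ k, IsRPow (a k) (p k) (c k)) :
    ∏ k, a k ≤ ∑ k, ((p k)⁻¹ * θ k) • c k := by
  choose d hd hcd using hc
  have hpn : ∀ x : A, x⁺ * x⁻ = 0 := fun x =>
    hol_mul_eq_zero hfalgA _ _ (posPart_inf_negPart_eq_zero x)
  have h1 : (0 : A) ≤ 1 := by
    have h2 := posPart_sub_negPart (1 : A)
    have h3 := hpn 1
    have e : (1 : A) = (1 : A)⁺ * (1 : A)⁺ + (1 : A)⁻ * (1 : A)⁻ := by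
      calc (1 : A) = 1 * 1 := by ring
        _ = ((1 : A)⁺ - (1 : A)⁻) * ((1 : A)⁺ - (1 : A)⁻) := by rw [h2]
        _ = _ := by linear_combination (-2) * h3
    rw [e]
    exact add_nonneg (hmulposA _ _ (posPart_nonneg _) (posPart_nonneg _))
      (hmulposA _ _ (negPart_nonneg _) (negPart_nonneg _))
  have hs : ∀ k, 0 ≤ p k - (⌊p k⌋₊ : ℝ) ∧ p k - (⌊p k⌋₊ : ℝ) < 1 := fun k => by
    have := Nat.floor_le (show 0 ≤ p k by linarith [hp k])
    have := Nat.lt_floor_add_one (p k)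
    constructor <;> linarith
  have hd0 : ∀ k, 0 ≤ d k := by
    intro k
    apply (hd k).2
    rintro _ ⟨t, u, ht, hu, -, rfl⟩
    exact add_nonneg (smul_nonneg (mul_nonneg (hs k).1 ht.le) (ha k))
      (smul_nonneg (mul_nonneg (by linarith [(hs k).2]) hu.le) h1)
  have hdx : ∀ k, ∀ x : ℝ, 0 < x →
      (x ^ (p k - (⌊p k⌋₊ : ℝ))) • ((1 : A) ⊓ x⁻¹ • a k) ≤ d k := by
    intro k x hx
    apply (hd k).2
    rintro _ ⟨t, u, ht, hu, htu, rfl⟩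
    set s := p k - (⌊p k⌋₊ : ℝ) with hsdef
    obtain ⟨hs0, hs1⟩ := hs k
    rw [← hsdef] at hs0 hs1
    set y := (1 : A) ⊓ x⁻¹ • a k with hy
    have hy0 : 0 ≤ y := le_inf h1 (smul_nonneg (inv_pos.mpr hx).le (ha k))
    have hy1 : y ≤ 1 := inf_le_left
    have hya : x • y ≤ a k := by
      have : y ≤ x⁻¹ • a k := inf_le_right
      have := smul_le_smul_of_nonneg_left this hx.le
      rwa [smul_smul, mul_inv_cancel₀ hx.ne', one_smul] at this
    have amgm : x ^ s ≤ s * (t * x) + (1 - s) * u := by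
      have := Real.geom_mean_le_arith_mean2_weighted hs0 (by linarith : 0 ≤ 1 - s)
        (mul_pos ht hx).le hu.le (by ring)
      rw [Real.mul_rpow ht.le hx.le] at this
      calc x ^ s = (t ^ s * u ^ (1 - s)) * x ^ s := by rw [htu, one_mul]
        _ = t ^ s * x ^ s * u ^ (1 - s) := by ring
        _ ≤ _ := this
    have e1 : (x ^ s) • y ≤ (s * (t * x) + (1 - s) * u) • y := by
      have := smul_nonneg (sub_nonneg.mpr amgm) hy0
      rw [sub_smul] at this
      exact sub_nonneg.mp this
    refine e1.trans ?_
    rw [add_smul]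
    refine add_le_add ?_ (smul_le_smul_of_nonneg_left hy1 (mul_nonneg (by linarith) hu.le))
    rw [← mul_assoc, mul_smul]
    exact smul_le_smul_of_nonneg_left hya (mul_nonneg hs0 ht.le)
  set u : A := 1 + ∑ k, a k ^ (⌊p k⌋₊ + 1) with hu
  have main : ∀ ε : ℝ, 0 < ε →
      0 ≤ (∑ k, ((p k)⁻¹ * θ k) • c k + ε • u) - ∏ k, a k := by
    intro ε hε
    by_contra hneg
    obtain ⟨I, L, hS, hφ, hle⟩ := hol_hom hmulposA hfalgA _ hneg
    have halg : ∀ r : ℝ, algebraMap ℝ (A ⧸ I) r = Ideal.Quotient.mk I (algebraMap ℝ A r) :=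
      fun r => rfl
    have hsm : ∀ (r : ℝ) (z : A), Ideal.Quotient.mk I (r • z)
        = algebraMap ℝ (A ⧸ I) r * Ideal.Quotient.mk I z := by
      intro r z
      rw [Algebra.smul_def, map_mul, halg]
    have := hol_core (R := A ⧸ I) n p θ hp hp1 hθ hθ1
      (fun k => Ideal.Quotient.mk I (a k)) (fun k => Ideal.Quotient.mk I (d k))
      (fun k => hφ _ (ha k)) (fun k => hφ _ (hd0 k)) (by
        intro k x hx hxa
        set y := (1 : A) ⊓ x⁻¹ • a k with hy
        have hι0 : 0 ≤ algebraMap ℝ (A ⧸ I) (x ^ (p k - (⌊p k⌋₊ : ℝ))) := by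
          rw [← Real.mul_self_sqrt (Real.rpow_nonneg hx.le _), map_mul]
          exact mul_self_nonneg _
        have hιx : 0 ≤ algebraMap ℝ (A ⧸ I) x⁻¹ := by
          rw [← Real.mul_self_sqrt (inv_pos.mpr hx).le, map_mul]
          exact mul_self_nonneg _
        have hz : (1 - y) * (x⁻¹ • a k - y) = 0 := by
          apply hol_mul_eq_zero hfalgA
          rw [← inf_sub, ← hy, sub_self]
        have hz' := congrArg (Ideal.Quotient.mk I) hz
        rw [map_mul, map_sub, map_sub, map_one, map_zero, hsm] at hz'
        have hge : 1 ≤ Ideal.Quotient.mk I y := by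
          rcases mul_eq_zero.mp hz' with h | h
          · exact (sub_eq_zero.mp h).le
          · rw [← sub_eq_zero.mp h]
            have := mul_le_mul_of_nonneg_left hxa hιx
            rwa [← map_mul, inv_mul_cancel₀ hx.ne', map_one] at this
        have h5 := hφ _ (sub_nonneg.mpr (hdx k x hx))
        rw [map_sub, hsm] at h5
        have h6 := mul_le_mul_of_nonneg_left hge hι0
        rw [mul_one] at h6
        exact h6.trans (sub_nonneg.mp h5)) ε hε
    rw [map_sub, map_add, map_sum, map_prod, hsm, hu, map_add, map_one, map_sum] at hle
    simp_rw [hsm, hcd, map_mul, map_pow] at hle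
    simp_rw [map_mul] at this
    exact absurd (sub_pos.mpr this) (not_lt.mpr hle)
  rw [← sub_nonpos]
  apply harchA _ u
  intro N
  have hu0 : 0 ≤ u := by
    have hpow : ∀ (z : A) (m : ℕ), 0 ≤ z → 0 ≤ z ^ m := by
      intro z m hz
      induction m with
      | zero => simpa using h1
      | succ m ih => rw [pow_succ]; exact hmulposA _ _ ih hz
    exact add_nonneg h1 (Finset.sum_nonneg fun k _ => hpow _ _ (ha k))
  rcases Nat.eq_zero_or_pos N with rfl | hN
  · simpa using hu0
  · have hN' : (0 : ℝ) < N := by exact_mod_cast hN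
    have h := main (N : ℝ)⁻¹ (inv_pos.mpr hN')
    have h' : ∏ k, a k - ∑ k, ((p k)⁻¹ * θ k) • c k ≤ (N : ℝ)⁻¹ • u := by
      rw [sub_le_iff_le_add, add_comm]
      exact sub_nonneg.mp h
    have := smul_le_smul_of_nonneg_left h' hN'.le
    rwa [smul_smul, mul_inv_cancel₀ hN'.ne', one_smul] at this

/-- **Theorem 4.7(2) (real case), Hölder inequality with vector lattice codomain.** For a
positive linear map `T : A → B` from a weighted geometric mean closed Archimedean
`Φ`-algebra into a weighted geometric mean closed Archimedean vector lattice and conjugate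
exponents `p₁, …, pₙ ∈ (1,∞)` with `Σₖ 1/pₖ = 1`,
`T(∏ₖ |aₖ|) ≤ △ₖ₌₁ⁿ (T(|aₖ|^{pₖ}), 1/pₖ)`; here `cₖ = |aₖ|^{pₖ}` in `A` and `m'` is the
weighted geometric mean of the `T cₖ` in `B`. -/
theorem stmt18 {A : Type*} [CommRing A] [Lattice A]
    [CovariantClass A A (· + ·) (· ≤ ·)]
    [Algebra ℝ A] [PosSMulMono ℝ A]
    {B : Type*} [AddCommGroup B] [Lattice B]
    [CovariantClass B B (· + ·) (· ≤ ·)]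
    [Module ℝ B] [PosSMulMono ℝ B]
    (harchA : ∀ f g : A, (∀ n : ℕ, (n : ℝ) • f ≤ g) → f ≤ 0)
    (hmulposA : ∀ a b : A, 0 ≤ a → 0 ≤ b → 0 ≤ a * b)
    (hfalgA : ∀ a b c : A, a ⊓ b = 0 → 0 ≤ c → (c * a) ⊓ b = 0)
    (hwgmA : ∀ (n : ℕ) (f : Fin n → A) (r : Fin n → ℝ),
      (∀ k, 0 < r k ∧ r k < 1) → (∑ k, r k) = 1 → ∃ m, IsGLB (wSet n f r) m)
    (harchB : ∀ f g : B, (∀ n : ℕ, (n : ℝ) • f ≤ g) → f ≤ 0)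
    (hwgmB : ∀ (n : ℕ) (f : Fin n → B) (r : Fin n → ℝ),
      (∀ k, 0 < r k ∧ r k < 1) → (∑ k, r k) = 1 → ∃ m, IsGLB (wSet n f r) m)
    (T : A →ₗ[ℝ] B) (hT : ∀ x : A, 0 ≤ x → 0 ≤ T x)
    (n : ℕ) (hn : 1 ≤ n)
    (p : Fin n → ℝ) (hp : ∀ k, 1 < p k) (hp1 : (∑ k, (p k)⁻¹) = 1)
    (a : Fin n → A)
    (c : Fin n → A) (hc : ∀ k, IsRPow |a k| (p k) (c k))
    (m' : B) (hm' : IsGLB (wSet n (fun k => T (c k)) (fun k => (p k)⁻¹)) m') :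
    T (∏ k, |a k|) ≤ m' := by
  apply hm'.2
  rintro _ ⟨θ, hθ, hθ1, rfl⟩
  have h := hol_A harchA hmulposA hfalgA n p θ hp hp1 hθ hθ1 (fun k => |a k|) c
    (fun k => abs_nonneg _) hc
  have h2 := hT _ (sub_nonneg.mpr h)
  rw [map_sub, sub_nonneg, map_sum] at h2
  refine h2.trans (Finset.sum_le_sum fun k _ => ?_)
  rw [map_smul]
  exact smul_le_smul_of_nonneg_left (le_abs_self _)
    (mul_nonneg (inv_nonneg.mpr (by linarith [hp k])) (hθ k).le)
end
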